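/- The dual canonical basis B* of O_q(M(n)) is invariant under multiplication by the quantum determinant: for every b ∈ B*, the product det_q · b again belongs to B*. -/

import Mathlib

open scoped TensorProduct

set_option synthInstance.maxHeartbeats 1000000
set_option maxHeartbeats 1000000

noncomputable section

/-- The base field `K = ℚ(q)`. -/
abbrev Kq : Type := RatFunc ℚ

/-- The indeterminate `q ∈ ℚ(q)`. -/
noncomputable def qq : Kq := RatFunc.X

/-- Matrices with nonnegative integer entries. -/
abbrev Mat (n : ℕ) := Matrix (Fin n) (Fin n) ℕ

/-- The defining relations of the quantum matrix algebra `O_q(M(n))`. -/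
inductive OqRel (n : ℕ) :
    FreeAlgebra Kq (Fin n × Fin n) → FreeAlgebra Kq (Fin n × Fin n) → Prop
  | rel_row {i j k : Fin n} (h : j < k) :
      OqRel n (FreeAlgebra.ι Kq (i, j) * FreeAlgebra.ι Kq (i, k))
        ((qq ^ 2) • (FreeAlgebra.ι Kq (i, k) * FreeAlgebra.ι Kq (i, j)))
  | rel_col {i k j : Fin n} (h : i < k) :
      OqRel n (FreeAlgebra.ι Kq (i, j) * FreeAlgebra.ι Kq (k, j))
        ((qq ^ 2) • (FreeAlgebra.ι Kq (k, j) * FreeAlgebra.ι Kq (i, j)))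
  | rel_anti {i j s t : Fin n} (h1 : s < i) (h2 : j < t) :
      OqRel n (FreeAlgebra.ι Kq (i, j) * FreeAlgebra.ι Kq (s, t))
        (FreeAlgebra.ι Kq (s, t) * FreeAlgebra.ι Kq (i, j))
  | rel_diag {i j s t : Fin n} (h1 : i < s) (h2 : j < t) :
      OqRel n (FreeAlgebra.ι Kq (i, j) * FreeAlgebra.ι Kq (s, t))
        (FreeAlgebra.ι Kq (s, t) * FreeAlgebra.ι Kq (i, j)
          + (qq ^ 2 - qq⁻¹ ^ 2) • (FreeAlgebra.ι Kq (i, t) * FreeAlgebra.ι Kq (s, j)))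

/-- The quantum matrix algebra `O_q(M(n))`. -/
abbrev Oq (n : ℕ) := RingQuot (OqRel n)

/-- The generator `x_{ij}` of `O_q(M(n))`. -/
noncomputable def xgen (n : ℕ) (i j : Fin n) : Oq n :=
  RingQuot.mkAlgHom Kq (OqRel n) (FreeAlgebra.ι Kq (i, j))

/-- The lexicographically ordered monomial `x^A`. -/
noncomputable def xMon (n : ℕ) (A : Mat n) : Oq n :=
  ((List.finRange n).map fun i =>
    ((List.finRange n).map fun j => xgen n i j ^ A i j).prod).prod
/-- The exponent appearing in `E(A)` and `D(A)`. -/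
def eExp (n : ℕ) (A : Mat n) : ℕ :=
  ∑ i, ∑ j, ∑ k ∈ Finset.univ.filter (fun k => k < j), (A i j * A i k + A j i * A k i)

/-- The modified monomial `x(A) = D(A) x^A`. -/
noncomputable def xMod (n : ℕ) (A : Mat n) : Oq n := (qq ^ (-(eExp n A : ℤ))) • xMon n A

/-- `matStep M M'` : `M'` is obtained from `M` by a single 2×2 submatrix transformation. -/
def matStep (n : ℕ) (M M' : Mat n) : Prop :=
  ∃ i s j t : Fin n, i < s ∧ j < t ∧ 1 ≤ M i j ∧ 1 ≤ M s t ∧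
    M' i j = M i j - 1 ∧ M' s t = M s t - 1 ∧ M' i t = M i t + 1 ∧ M' s j = M s j + 1 ∧
    ∀ u v : Fin n,
      ¬((u = i ∧ v = j) ∨ (u = s ∧ v = t) ∨ (u = i ∧ v = t) ∨ (u = s ∧ v = j)) →
        M' u v = M u v

/-- `matLT B A` : `B < A`, i.e. `B` is obtained from `A` by a nonempty sequence of
2×2 submatrix transformations. -/
def matLT (n : ℕ) (B A : Mat n) : Prop := Relation.TransGen (matStep n) A B

/-- Membership in `ℤ[q] ⊆ ℚ(q)`. -/
def inZq (c : Kq) : Prop := c ∈ Subring.closure ({qq} : Set Kq)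

/-- Membership in `qℤ[q] ⊆ ℚ(q)`. -/
def inQZq (c : Kq) : Prop := ∃ d : Kq, inZq d ∧ c = qq * d

/-- Membership in `ℤ[q, q⁻¹] ⊆ ℚ(q)`. -/
def inZLaurent (c : Kq) : Prop := c ∈ Subring.closure ({qq, qq⁻¹} : Set Kq)

/-- `bar` is the bar involution: a `ℚ`-algebra anti-automorphism fixing the `x_{ij}`
and semilinear with respect to `q ↦ q⁻¹`. -/
def IsBar (n : ℕ) (bar : Oq n → Oq n) : Prop :=
  Function.Bijective bar ∧
  (∀ a b : Oq n, bar (a + b) = bar a + bar b) ∧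
  (∀ (r : ℚ) (a : Oq n), bar ((r : Kq) • a) = (r : Kq) • bar a) ∧
  (∀ a b : Oq n, bar (a * b) = bar b * bar a) ∧
  bar 1 = 1 ∧
  (∀ i j, bar (xgen n i j) = xgen n i j) ∧
  (∀ a : Oq n, bar (qq • a) = qq⁻¹ • bar a)

/-- Membership in the `ℤ[q]`-lattice `L* = ⊕_A ℤ[q]·x(A)`. -/
def memLstar (n : ℕ) (v : Oq n) : Prop :=
  ∃ (F : Finset (Mat n)) (h : Mat n → Kq),
    (∀ A ∈ F, inZq (h A)) ∧ v = ∑ A ∈ F, h A • xMod n A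

/-- `b` is the dual canonical basis of `O_q(M(n))` relative to the bar involution `bar`:
each `b A` is bar-invariant, is `x(A)` plus a `qℤ[q]`-combination of `x(B)` with `B < A`,
and the family is a `ℤ[q]`-basis of `L*`. -/
def IsDCB (n : ℕ) (bar : Oq n → Oq n) (b : Mat n → Oq n) : Prop :=
  (∀ A, bar (b A) = b A) ∧
  (∀ A, ∃ (F : Finset (Mat n)) (h : Mat n → Kq),
      (∀ B ∈ F, matLT n B A ∧ inQZq (h B)) ∧
      b A = xMod n A + ∑ B ∈ F, h B • xMod n B) ∧
  (∀ v, memLstar n v → ∃ (F : Finset (Mat n)) (h : Mat n → Kq),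
      (∀ A ∈ F, inZq (h A)) ∧ v = ∑ A ∈ F, h A • b A) ∧
  (∀ (F : Finset (Mat n)) (h : Mat n → Kq), (∀ A ∈ F, inZq (h A)) →
      ∑ A ∈ F, h A • b A = 0 → ∀ A ∈ F, h A = 0)
/-- The number of inversions (the length) of a permutation. -/
def invCount {m : ℕ} (σ : Equiv.Perm (Fin m)) : ℕ :=
  ((Finset.univ : Finset (Fin m × Fin m)).filter fun p => p.1 < p.2 ∧ σ p.2 < σ p.1).card

/-- The quantum minor `det_q(I, J)` (defined to be `0` when `|I| ≠ |J|`). -/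
noncomputable def qMinor (n : ℕ) (I J : Finset (Fin n)) : Oq n :=
  if h : J.card = I.card then
    ∑ σ : Equiv.Perm (Fin I.card),
      ((-(qq ^ 2)) ^ invCount σ) •
        ((List.finRange I.card).map fun r =>
          xgen n ((I.orderIsoOfFin rfl r : {x // x ∈ I}) : Fin n)
            ((J.orderIsoOfFin h (σ r) : {x // x ∈ J}) : Fin n)).prod
  else 0

/-- The quantum determinant `det_q ∈ O_q(M(n))`. -/
noncomputable def qDet (n : ℕ) : Oq n :=
  ∑ σ : Equiv.Perm (Fin n),
    ((-(qq ^ 2)) ^ invCount σ) • ((List.finRange n).map fun i => xgen n i (σ i)).prod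

/-- The relation imposing `det_q = 1`. -/
def SLRel (n : ℕ) : Oq n → Oq n → Prop := fun a b => a = qDet n ∧ b = 1

/-- The quantized function algebra `O_q(SL(n)) = O_q(M(n))/⟨det_q - 1⟩`. -/
abbrev OqSL (n : ℕ) := RingQuot (SLRel n)

/-- The canonical projection `T : O_q(M(n)) → O_q(SL(n))`. -/
noncomputable def Tmap (n : ℕ) : Oq n →ₐ[Kq] OqSL n := RingQuot.mkAlgHom Kq (SLRel n)

/-- The image of the generator `x_{ij}` in `O_q(SL(n))`. -/
noncomputable def Xbar (n : ℕ) (i j : Fin n) : OqSL n := Tmap n (xgen n i j)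

section QuantumMinors

variable {K O : Type*} [Field K] [Ring O] [Algebra K O] {n : ℕ}

/-- `u` to the number of columns of `S` with index less than `m`. -/
def colWt (u : K) (S : Finset (Fin n)) (m : ℕ) : K :=
  u ^ (S.filter fun c : Fin n => (c : ℕ) < m).card

/-- The quantum minor on the rows listed in `w` and the columns in `S`, defined by Laplace
expansion along the first row. -/
def rowMinor (u : K) (x : Fin n → Fin n → O) : List (Fin n) → Finset (Fin n) → O
  | [], S => if S = ∅ then 1 else 0
  | i :: w, S => ∑ p ∈ S, colWt u S p • (x i p * rowMinor u x w (S.erase p))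

/-- The relations of a quantum matrix, with parameter `u = -q²` and every product of two
entries rewritten into the lexicographic order. -/
structure IsQuantumMatrix (u : K) (x : Fin n → Fin n → O) : Prop where
  ne_zero : u ≠ 0
  row : ∀ {i j k : Fin n}, j < k → x i k * x i j = (-u⁻¹) • (x i j * x i k)
  col : ∀ {i k j : Fin n}, i < k → x k j * x i j = (-u⁻¹) • (x i j * x k j)
  anti : ∀ {i j s t : Fin n}, s < i → j < t → x i j * x s t = x s t * x i j
  diag : ∀ {i j s t : Fin n}, i < s → j < t →
    x s t * x i j = x i j * x s t - (u⁻¹ - u) • (x i t * x s j)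

theorem colWt_ne_zero {u : K} (hu : u ≠ 0) (S : Finset (Fin n)) (m : ℕ) : colWt u S m ≠ 0 :=
  pow_ne_zero _ hu

theorem colWt_insert_of_le (u : K) {S : Finset (Fin n)} {l : Fin n} {m : ℕ} (h : m ≤ l) :
    colWt u (insert l S) m = colWt u S m := by
  rw [colWt, colWt, Finset.filter_insert, if_neg (not_lt.mpr h)]

theorem colWt_insert_of_lt (u : K) {S : Finset (Fin n)} {l : Fin n} (hl : l ∉ S) {m : ℕ}
    (h : (l : ℕ) < m) : colWt u (insert l S) m = u * colWt u S m := by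
  rw [colWt, colWt, Finset.filter_insert, if_pos h, Finset.card_insert_of_notMem (by simp [hl]),
    pow_succ']

theorem colWt_erase_of_le (u : K) {S : Finset (Fin n)} {l : Fin n} (hl : l ∈ S) {m : ℕ}
    (h : m ≤ l) : colWt u (S.erase l) m = colWt u S m := by
  conv_rhs => rw [← Finset.insert_erase hl]
  rw [colWt_insert_of_le u h]

theorem colWt_erase_of_lt {u : K} (hu : u ≠ 0) {S : Finset (Fin n)} {l : Fin n} (hl : l ∈ S)
    {m : ℕ} (h : (l : ℕ) < m) : colWt u (S.erase l) m = u⁻¹ * colWt u S m := by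
  conv_rhs => rw [← Finset.insert_erase hl]
  rw [colWt_insert_of_lt u (by simp) h, inv_mul_cancel_left₀ hu]

theorem colWt_succ_of_mem {u : K} {S : Finset (Fin n)} {l : Fin n} (hl : l ∈ S) :
    colWt u S ((l : ℕ) + 1) = u * colWt u S l := by
  conv_lhs => rw [← Finset.insert_erase hl]
  conv_rhs => rw [← Finset.insert_erase hl]
  rw [colWt_insert_of_lt u (by simp) (by omega), colWt_insert_of_le u le_rfl, colWt, colWt]
  congr 3
  ext c
  simp only [Finset.mem_filter, Finset.mem_erase, and_congr_right_iff, and_imp, ne_eq, Fin.ext_iff]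
  intros; omega

theorem colWt_succ_of_notMem {u : K} {S : Finset (Fin n)} {l : Fin n} (hl : l ∉ S) :
    colWt u S ((l : ℕ) + 1) = colWt u S l := by
  rw [colWt, colWt]
  congr 2
  ext c
  simp only [Finset.mem_filter, and_congr_right_iff]
  intro hc
  have : (c : ℕ) ≠ l := fun h => hl (Fin.ext h ▸ hc)
  omega

theorem sum_offDiag_eq_zero [CharZero K] {T : Finset (Fin n)} {F : Fin n → Fin n → O}
    (h : ∀ p ∈ T, ∀ s ∈ T, p < s → F p s + F s p = 0) :
    ∑ s ∈ T, ∑ p ∈ T.erase s, F p s = 0 := by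
  have key : ∑ s ∈ T, ∑ p ∈ T.erase s, F p s = ∑ s ∈ T, ∑ p ∈ T.erase s, F s p :=
    Finset.sum_comm' (by simp only [Finset.mem_erase]; grind)
  have h2 : (2 : K) • ∑ s ∈ T, ∑ p ∈ T.erase s, F p s = 0 := by
    rw [two_smul]
    nth_rewrite 2 [key]
    rw [← Finset.sum_add_distrib]
    refine Finset.sum_eq_zero fun s hs => ?_
    rw [← Finset.sum_add_distrib]
    refine Finset.sum_eq_zero fun p hp => ?_
    obtain ⟨hne, hp⟩ := Finset.mem_erase.mp hp
    rcases lt_or_gt_of_ne hne with hlt | hlt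
    · exact h p hp s hs hlt
    · rw [add_comm]; exact h s hs p hp hlt
  exact (smul_eq_zero.mp h2).resolve_left two_ne_zero

/-- The part of the Laplace expansion of a quantum minor along the row `i` that involves the
columns of index at least `m`, normalized to have leading coefficient `1`. -/
def tailMinor (u : K) (x : Fin n → Fin n → O) (i : Fin n) (w : List (Fin n)) (m : ℕ)
    (S : Finset (Fin n)) : O :=
  ∑ p ∈ S.filter (fun p : Fin n => m ≤ p),
    (colWt u S p * (colWt u S m)⁻¹) • (x i p * rowMinor u x w (S.erase p))

theorem tailMinor_zero (u : K) (x : Fin n → Fin n → O) (i : Fin n) (w : List (Fin n))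
    (S : Finset (Fin n)) : tailMinor u x i w 0 S = rowMinor u x (i :: w) S := by
  simp [tailMinor, rowMinor, colWt]

theorem tailMinor_eq_zero (u : K) (x : Fin n → Fin n → O) (i : Fin n) (w : List (Fin n))
    (S : Finset (Fin n)) : tailMinor u x i w n S = 0 := by
  rw [tailMinor, Finset.filter_false_of_mem (fun p _ => by have := p.2; omega), Finset.sum_empty]

theorem tailMinor_of_notMem (u : K) (x : Fin n → Fin n → O) (i : Fin n) (w : List (Fin n))
    {l : Fin n} {S : Finset (Fin n)} (hl : l ∉ S) :
    tailMinor u x i w l S = tailMinor u x i w (l + 1) S := by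
  rw [tailMinor, tailMinor, colWt_succ_of_notMem hl]
  refine Finset.sum_congr ?_ fun _ _ => rfl
  ext c
  simp only [Finset.mem_filter, and_congr_right_iff]
  intro hc
  have : (c : ℕ) ≠ l := fun h => hl (Fin.ext h ▸ hc)
  omega

theorem tailMinor_of_mem {u : K} (hu : u ≠ 0) (x : Fin n → Fin n → O) (i : Fin n)
    (w : List (Fin n)) {l : Fin n} {S : Finset (Fin n)} (hl : l ∈ S) :
    tailMinor u x i w l S =
      x i l * rowMinor u x w (S.erase l) + u • tailMinor u x i w (l + 1) S := by
  have hf : S.filter (fun p : Fin n => (l : ℕ) ≤ p) =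
      insert l (S.filter fun p : Fin n => (l : ℕ) + 1 ≤ p) := by
    ext c
    simp only [Finset.mem_filter, Finset.mem_insert, Fin.ext_iff]
    constructor
    · rintro ⟨h1, h2⟩
      by_cases h : (c : ℕ) = l
      · exact Or.inl h
      · exact Or.inr ⟨h1, by omega⟩
    · rintro (h | ⟨h1, h2⟩)
      · exact ⟨Fin.ext h ▸ hl, h.ge⟩
      · exact ⟨h1, by omega⟩
  rw [tailMinor, hf, Finset.sum_insert (by simp), mul_inv_cancel₀ (colWt_ne_zero hu _ _), one_smul,
    tailMinor, Finset.smul_sum, colWt_succ_of_mem hl]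
  congr 1
  refine Finset.sum_congr rfl fun p _ => ?_
  rw [smul_smul]
  congr 1
  have := colWt_ne_zero hu S l
  field_simp

theorem tailMinor_succ_insert {u : K} (hu : u ≠ 0) (x : Fin n → Fin n → O) (i : Fin n)
    (w : List (Fin n)) {l : Fin n} {S : Finset (Fin n)} (hl : l ∉ S) :
    tailMinor u x i w (l + 1) (insert l S) = ∑ p ∈ S.filter (fun p => l < p),
      (colWt u S p * (colWt u S l)⁻¹) • (x i p * rowMinor u x w (insert l (S.erase p))) := by
  rw [tailMinor]
  refine Finset.sum_congr ?_ fun p hp => ?_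
  · ext c
    simp only [Finset.mem_filter, Finset.mem_insert, Fin.lt_def, Fin.ext_iff]
    grind
  · obtain ⟨_, hp⟩ := Finset.mem_filter.mp hp
    rw [colWt_insert_of_lt u hl hp, colWt_insert_of_lt u hl (by omega),
      colWt_succ_of_notMem hl, Finset.erase_insert_of_ne hp.ne]
    congr 1
    have := colWt_ne_zero hu S l
    field_simp

namespace IsQuantumMatrix

variable {u : K} {x : Fin n → Fin n → O}

theorem rowMinor_mul_aux [CharZero K] (hx : IsQuantumMatrix u x) {i : Fin n} {w : List (Fin n)}
    (hw : ∀ r ∈ w, i < r) (S : Finset (Fin n)) (l : Fin n) :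
    (l ∈ S → rowMinor u x w S * x i l = (-u⁻¹) • (x i l * rowMinor u x w S)) ∧
    (l ∉ S → rowMinor u x w S * x i l = x i l * rowMinor u x w S -
      (u⁻¹ - u) • tailMinor u x i w (l + 1) (insert l S)) := by
  have hu := hx.ne_zero
  induction w generalizing S l with
  | nil =>
    constructor
    · intro hl
      simp [rowMinor, Finset.ne_empty_of_mem hl]
    · intro hl
      rw [tailMinor_succ_insert hu _ _ _ hl, Finset.sum_eq_zero, smul_zero, sub_zero]
      · rw [rowMinor]; split_ifs <;> simp
      · simp [rowMinor]
  | cons r w ih =>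
    have hir : i < r := hw r (by simp)
    replace ih := ih (fun s hs => hw s (by simp [hs]))
    constructor
    · intro hl
      rw [rowMinor, Finset.sum_mul, Finset.mul_sum, Finset.smul_sum]
      rw [← Finset.add_sum_erase _ _ hl, ← Finset.add_sum_erase _ _ hl]
      have hrest : ∀ p ∈ S.erase l,
          colWt u S p • (x r p * rowMinor u x w (S.erase p)) * x i l =
          (-u⁻¹) • (x i l * colWt u S p • (x r p * rowMinor u x w (S.erase p))) +
          (if l < p then (u⁻¹ * (u⁻¹ - u) * colWt u S p) •
            (x i p * (x r l * rowMinor u x w (S.erase p))) else 0) := by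
        intro p hp
        obtain ⟨hpl, hpS⟩ := Finset.mem_erase.mp hp
        have h1 := (ih (S.erase p) l).1 (Finset.mem_erase.mpr ⟨hpl.symm, hl⟩)
        rw [smul_mul_assoc, mul_assoc, h1, mul_smul_comm, ← mul_assoc, mul_smul_comm, ← mul_assoc]
        split_ifs with hlp
        · rw [hx.diag hir hlp, sub_mul, smul_mul_assoc, mul_assoc (x i p)]
          module
        · rw [hx.anti hir (lt_of_le_of_ne (not_lt.mp hlp) hpl)]
          module
      rw [Finset.sum_congr rfl hrest, Finset.sum_add_distrib, smul_mul_assoc, mul_assoc,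
        (ih (S.erase l) l).2 (by simp), tailMinor_succ_insert hu _ _ _ (by simp), mul_sub,
        mul_smul_comm, ← mul_assoc, hx.col hir, ← Finset.sum_filter, Finset.mul_sum]
      have hf : (S.erase l).filter (fun p => l < p) = S.filter fun p => l < p := by
        ext c; simp only [Finset.mem_filter, Finset.mem_erase]; grind
      rw [hf]
      have hs : ∑ p ∈ S.filter (fun p => l < p), (u⁻¹ * (u⁻¹ - u) * colWt u S p) •
            (x i p * (x r l * rowMinor u x w (S.erase p))) =
          (colWt u S l * (u⁻¹ - u)) • ∑ p ∈ S.filter (fun p => l < p), x r l *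
            (colWt u (S.erase l) p * (colWt u (S.erase l) l)⁻¹) •
              (x i p * rowMinor u x w (insert l ((S.erase l).erase p))) := by
        rw [Finset.smul_sum]
        refine Finset.sum_congr rfl fun p hp => ?_
        obtain ⟨hpS, hlp⟩ := Finset.mem_filter.mp hp
        rw [Finset.erase_right_comm, Finset.insert_erase (Finset.mem_erase.mpr ⟨hlp.ne, hl⟩),
          mul_smul_comm, ← mul_assoc (x r l), hx.anti hir hlp, smul_smul, mul_assoc (x i p),
          colWt_erase_of_lt hu hl hlp, colWt_erase_of_le u hl le_rfl]
        congr 1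
        have := colWt_ne_zero hu S l
        field_simp
      rw [hs, mul_smul_comm]
      simp only [smul_mul_assoc, mul_assoc]
      module
    · intro hl
      set T := S.filter (fun p => l < p) with hT
      set D : Finset (Fin n) → O := rowMinor u x w with hD
      have hTS : ∀ {p}, p ∈ T → p ∈ S ∧ l < p := fun h => Finset.mem_filter.mp h
      have hne : ∀ {p}, p ∈ S → p ≠ l := fun h e => hl (e ▸ h)
      have hL : rowMinor u x (r :: w) S * x i l =
          (∑ p ∈ S, colWt u S p • (x r p * x i l * D (S.erase p))) -
          (u⁻¹ - u) • ∑ s ∈ T, ∑ p ∈ S.erase s,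
            (colWt u S p * (colWt u (S.erase p) s * (colWt u (S.erase p) l)⁻¹)) •
              (x r p * x i s * D (insert l ((S.erase p).erase s))) := by
        rw [Finset.sum_comm' (t' := S) (s' := fun p => (S.erase p).filter fun s => l < s)
          (by simp only [hT, Finset.mem_filter, Finset.mem_erase]; grind), Finset.smul_sum,
          ← Finset.sum_sub_distrib, rowMinor, Finset.sum_mul]
        refine Finset.sum_congr rfl fun p hp => ?_
        rw [smul_mul_assoc, mul_assoc, (ih (S.erase p) l).2 (by simp [hl]),
          tailMinor_succ_insert hu _ _ _ (by simp [hl]), mul_sub, smul_sub, ← mul_assoc]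
        congr 1
        rw [mul_smul_comm, Finset.mul_sum, smul_comm, Finset.smul_sum]
        congr 1
        refine Finset.sum_congr rfl fun s _ => ?_
        rw [mul_smul_comm, smul_smul, mul_assoc]
      have hR : tailMinor u x i (r :: w) (l + 1) (insert l S) =
          (∑ s ∈ T, colWt u S s • (x i s * x r l * D (S.erase s))) +
          ∑ s ∈ T, ∑ p ∈ S.erase s,
            ((colWt u S s * (colWt u S l)⁻¹) * colWt u (insert l (S.erase s)) p) •
              (x i s * x r p * D (insert l ((S.erase p).erase s))) := by
        rw [tailMinor_succ_insert hu _ _ _ hl, ← Finset.sum_add_distrib]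
        refine Finset.sum_congr rfl fun s hs => ?_
        obtain ⟨hsS, hls⟩ := hTS hs
        rw [rowMinor, Finset.sum_insert (by simp [hl]), mul_add, smul_add]
        congr 1
        · rw [Finset.erase_insert (by simp [hl]), colWt_insert_of_le u le_rfl,
            colWt_erase_of_le u hsS (Fin.le_def.mp hls.le), mul_smul_comm, smul_smul,
            mul_assoc (x i s)]
          congr 1
          have := colWt_ne_zero hu S l
          field_simp
        · rw [Finset.mul_sum, Finset.smul_sum]
          refine Finset.sum_congr rfl fun p hp => ?_
          rw [mul_smul_comm, smul_smul, Finset.erase_insert_of_ne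
            (hne (Finset.mem_of_mem_erase hp)).symm, Finset.erase_right_comm, mul_assoc (x i s)]
      have h1 : ∑ p ∈ S, colWt u S p • (x r p * x i l * D (S.erase p)) =
          x i l * rowMinor u x (r :: w) S -
            (u⁻¹ - u) • ∑ s ∈ T, colWt u S s • (x i s * x r l * D (S.erase s)) := by
        rw [rowMinor, Finset.mul_sum, hT, Finset.sum_filter, Finset.smul_sum,
          ← Finset.sum_sub_distrib]
        refine Finset.sum_congr rfl fun p hp => ?_
        split_ifs with hlp
        · rw [hx.diag hir hlp, sub_mul, smul_mul_assoc, mul_smul_comm, mul_assoc (x i l)]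
          module
        · rw [hx.anti hir (lt_of_le_of_ne (not_lt.mp hlp) (hne hp)), mul_smul_comm, mul_assoc,
            smul_zero, sub_zero]
      have h2 : ∑ s ∈ T, ∑ p ∈ S.erase s,
            ((colWt u S p * (colWt u (S.erase p) s * (colWt u (S.erase p) l)⁻¹)) •
              (x r p * x i s * D (insert l ((S.erase p).erase s))) -
            ((colWt u S s * (colWt u S l)⁻¹) * colWt u (insert l (S.erase s)) p) •
              (x i s * x r p * D (insert l ((S.erase p).erase s)))) = 0 := by
        rw [← sum_offDiag_eq_zero (K := K) (T := T) (F := fun p s =>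
            ((colWt u S p * (colWt u (S.erase p) s * (colWt u (S.erase p) l)⁻¹)) •
              (x r p * x i s * D (insert l ((S.erase p).erase s))) -
            ((colWt u S s * (colWt u S l)⁻¹) * colWt u (insert l (S.erase s)) p) •
              (x i s * x r p * D (insert l ((S.erase p).erase s)))))]
        · refine Finset.sum_congr rfl fun s hs => (Finset.sum_subset ?_ ?_).symm
          · exact Finset.erase_subset_erase _ (Finset.filter_subset _ _)
          · intro p hp hp'
            obtain ⟨hps, hpS⟩ := Finset.mem_erase.mp hp
            obtain ⟨hsS, hls⟩ := hTS hs
            have hpl : p < l := by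
              refine lt_of_le_of_ne (not_lt.mp fun h => hp' ?_) (hne hpS)
              exact Finset.mem_erase.mpr ⟨hps, Finset.mem_filter.mpr ⟨hpS, h⟩⟩
            have hlp' : p < s := hpl.trans hls
            rw [hx.anti hir hlp', colWt_erase_of_lt hu hpS hlp', colWt_erase_of_lt hu hpS hpl,
              colWt_insert_of_le u hpl.le, colWt_erase_of_le u hsS hlp'.le, ← sub_smul]
            have := colWt_ne_zero hu S l
            convert zero_smul K _
            field_simp
            ring
        · intro p hp s hs hps
          obtain ⟨hsS, hls⟩ := hTS hs
          obtain ⟨hpS, hlp⟩ := hTS hp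
          rw [hx.anti hir hps, hx.diag hir hps, Finset.erase_right_comm (a := s),
            colWt_erase_of_lt hu hpS hps, colWt_erase_of_le u hpS hlp.le,
            colWt_insert_of_lt u (by simp [hl]) hlp, colWt_erase_of_le u hsS hps.le,
            colWt_erase_of_le u hsS hls.le, colWt_insert_of_lt u (by simp [hl]) hls,
            colWt_erase_of_lt hu hpS hps, sub_mul, smul_mul_assoc]
          have := colWt_ne_zero hu S l
          match_scalars
          · field_simp; ring
          · field_simp; ring
      rw [hL, hR, h1, smul_add, ← sub_sub, sub_right_inj]
      congr 1
      rw [← sub_eq_zero, ← h2]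
      simp only [Finset.sum_sub_distrib]

theorem rowMinor_mul_of_mem [CharZero K] (hx : IsQuantumMatrix u x) {i : Fin n} {w : List (Fin n)}
    (hw : ∀ r ∈ w, i < r) {S : Finset (Fin n)} {l : Fin n} (hl : l ∈ S) :
    rowMinor u x w S * x i l = (-u⁻¹) • (x i l * rowMinor u x w S) :=
  (hx.rowMinor_mul_aux hw S l).1 hl

theorem rowMinor_mul_of_notMem [CharZero K] (hx : IsQuantumMatrix u x) {i : Fin n}
    {w : List (Fin n)}
    (hw : ∀ r ∈ w, i < r) {S : Finset (Fin n)} {l : Fin n} (hl : l ∉ S) :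
    rowMinor u x w S * x i l = x i l * rowMinor u x w S -
      (u⁻¹ - u) • tailMinor u x i w (l + 1) (insert l S) :=
  (hx.rowMinor_mul_aux hw S l).2 hl

theorem tailMinor_succ_mul_of_mem [CharZero K] (hx : IsQuantumMatrix u x) {i : Fin n}
    {w : List (Fin n)}
    (hw : ∀ r ∈ w, i < r) {S : Finset (Fin n)} {l : Fin n} (hl : l ∈ S) :
    tailMinor u x i w (l + 1) S * x i l =
      ((u⁻¹) ^ 2) • (x i l * tailMinor u x i w (l + 1) S) := by
  rw [tailMinor, Finset.sum_mul, Finset.mul_sum, Finset.smul_sum]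
  refine Finset.sum_congr rfl fun p hp => ?_
  obtain ⟨hpS, hlp⟩ := Finset.mem_filter.mp hp
  have hlp : l < p := hlp
  rw [smul_mul_assoc, mul_assoc, hx.rowMinor_mul_of_mem hw (Finset.mem_erase.mpr ⟨hlp.ne, hl⟩),
    mul_smul_comm, ← mul_assoc, hx.row hlp, mul_smul_comm, smul_mul_assoc, mul_assoc]
  module

theorem tailMinor_mul_of_mem [CharZero K] (hx : IsQuantumMatrix u x) {i : Fin n} {w : List (Fin n)}
    (hw : ∀ r ∈ w, i < r) {S : Finset (Fin n)} {l : Fin n} (hl : l ∈ S) :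
    tailMinor u x i w l S * x i l = x i l * tailMinor u x i w l S := by
  have hu := hx.ne_zero
  rw [tailMinor_of_mem hu _ _ _ hl, add_mul, smul_mul_assoc, hx.tailMinor_succ_mul_of_mem hw hl,
    mul_assoc, hx.rowMinor_mul_of_notMem hw (S.notMem_erase l), Finset.insert_erase hl, mul_sub,
    mul_add, mul_smul_comm, mul_smul_comm]
  match_scalars
  · simp
  · field_simp; ring

theorem tailMinor_succ_mul_of_notMem [CharZero K] (hx : IsQuantumMatrix u x) {i : Fin n}
    {w : List (Fin n)}
    (hw : ∀ r ∈ w, i < r) {S : Finset (Fin n)} {l : Fin n} (hl : l ∉ S) :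
    tailMinor u x i w (l + 1) S * x i l = (-u⁻¹) • (x i l * tailMinor u x i w (l + 1) S) := by
  have hu := hx.ne_zero
  set T := S.filter (fun p => l < p) with hT
  have hTS : ∀ {p}, p ∈ T → p ∈ S ∧ l < p := fun h => Finset.mem_filter.mp h
  have hne : ∀ {p}, p ∈ S → p ≠ l := fun h e => hl (e ▸ h)
  have hdef : tailMinor u x i w (l + 1) S = ∑ p ∈ T,
      (colWt u S p * (colWt u S ((l : ℕ) + 1))⁻¹) • (x i p * rowMinor u x w (S.erase p)) := rfl
  have hdouble : ∑ s ∈ T, ∑ p ∈ T.erase s, (colWt u S p * colWt u (S.erase p) s) •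
      (x i p * x i s * rowMinor u x w (insert l ((S.erase p).erase s))) = 0 := by
    refine sum_offDiag_eq_zero (K := K) (F := fun p s => (colWt u S p * colWt u (S.erase p) s) •
      (x i p * x i s * rowMinor u x w (insert l ((S.erase p).erase s)))) ?_
    intro p hp s hs hps
    rw [hx.row hps, Finset.erase_right_comm (a := s), colWt_erase_of_lt hu (hTS hp).1 hps,
      colWt_erase_of_le u (hTS hs).1 hps.le, smul_mul_assoc]
    module
  have hterm : ∀ p ∈ T, (colWt u S p * (colWt u S ((l : ℕ) + 1))⁻¹) •
        (x i p * rowMinor u x w (S.erase p)) * x i l =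
      (-u⁻¹) • (x i l * (colWt u S p * (colWt u S ((l : ℕ) + 1))⁻¹) •
        (x i p * rowMinor u x w (S.erase p))) -
      ((u⁻¹ - u) * ((colWt u S ((l : ℕ) + 1))⁻¹ * (colWt u S l)⁻¹)) • ∑ s ∈ T.erase p,
        (colWt u S p * colWt u (S.erase p) s) •
          (x i p * x i s * rowMinor u x w (insert l ((S.erase p).erase s))) := by
    intro p hp
    obtain ⟨hpS, hlp⟩ := hTS hp
    have hf : (S.erase p).filter (fun s => l < s) = T.erase p := by
      ext c; simp only [hT, Finset.mem_filter, Finset.mem_erase]; grind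
    rw [smul_mul_assoc, mul_assoc, hx.rowMinor_mul_of_notMem hw (by simp [hl]),
      tailMinor_succ_insert hu _ _ _ (by simp [hl]), mul_sub, smul_sub, ← mul_assoc, hx.row hlp]
    congr 1
    · rw [mul_smul_comm, smul_mul_assoc, mul_assoc]
      module
    · rw [hf, mul_smul_comm, Finset.mul_sum, smul_smul, Finset.smul_sum, Finset.smul_sum]
      refine Finset.sum_congr rfl fun s _ => ?_
      rw [mul_smul_comm, colWt_erase_of_le u hpS (Fin.le_def.mp hlp.le), mul_assoc (x i p)]
      module
  rw [hdef, Finset.sum_mul, Finset.sum_congr rfl hterm, Finset.sum_sub_distrib,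
    ← Finset.smul_sum, ← Finset.smul_sum, ← Finset.mul_sum,
    Finset.sum_comm' (t' := T) (s' := fun s => T.erase s)
      (by simp only [Finset.mem_erase]; grind), hdouble, smul_zero, sub_zero]

theorem mul_pow_of_mul_eq_smul {c : K} {y z : O} (h : y * z = c • (z * y)) (a : ℕ) :
    y * z ^ a = c ^ a • (z ^ a * y) := by
  induction a with
  | zero => simp
  | succ a ih =>
    rw [pow_succ, ← mul_assoc, ih, smul_mul_assoc, mul_assoc, h, mul_smul_comm, smul_smul,
      ← mul_assoc, pow_succ]

theorem rowMinor_mul_pow_of_notMem [CharZero K] (hx : IsQuantumMatrix u x) {i : Fin n}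
    {w : List (Fin n)}
    (hw : ∀ r ∈ w, i < r) {S : Finset (Fin n)} {l : Fin n} (hl : l ∉ S) (a : ℕ) :
    rowMinor u x w S * x i l ^ a = x i l ^ a * rowMinor u x w S +
      (u * (1 - u⁻¹ ^ (2 * a))) • (x i l ^ (a - 1) * tailMinor u x i w (l + 1) (insert l S)) := by
  have hu := hx.ne_zero
  induction a with
  | zero => simp
  | succ a ih =>
    rw [pow_succ, ← mul_assoc, ih, add_mul, smul_mul_assoc, mul_assoc, mul_assoc,
      hx.tailMinor_succ_mul_of_mem hw (Finset.mem_insert_self l S),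
      hx.rowMinor_mul_of_notMem hw hl, mul_sub, mul_smul_comm, mul_smul_comm,
      ← mul_assoc _ (x i l), ← mul_assoc _ (x i l), Nat.add_sub_cancel]
    rcases a with _ | a
    · simp only [mul_zero, pow_zero, sub_self, zero_smul, add_zero, one_mul, zero_add, mul_one]
      match_scalars
      · simp
      · field_simp; ring
    · rw [Nat.add_sub_cancel, ← pow_succ, ← pow_succ]
      match_scalars
      · simp
      · linear_combination u⁻¹ * mul_inv_cancel₀ hu

theorem sum_colWt_inv_sq (hu : u ≠ 0) (S : Finset (Fin n)) {m : ℕ} (hm : m ≤ n) :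
    (u⁻¹ ^ 2 - 1) * ∑ p ∈ S.filter (fun p : Fin n => (p : ℕ) < m), (colWt u S p)⁻¹ ^ 2 =
      (colWt u S m)⁻¹ ^ 2 - 1 := by
  induction m with
  | zero => simp [colWt]
  | succ m ih =>
    specialize ih (by omega)
    by_cases hl : (⟨m, hm⟩ : Fin n) ∈ S
    · have hf : S.filter (fun p : Fin n => (p : ℕ) < m + 1) =
          insert ⟨m, hm⟩ (S.filter fun p : Fin n => (p : ℕ) < m) := by
        ext c
        simp only [Finset.mem_filter, Finset.mem_insert, Fin.ext_iff]
        constructor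
        · rintro ⟨h1, h2⟩
          by_cases h : (c : ℕ) = m
          · exact Or.inl h
          · exact Or.inr ⟨h1, by omega⟩
        · rintro (h | ⟨h1, h2⟩)
          · exact ⟨(Fin.ext h : c = ⟨m, hm⟩) ▸ hl, by omega⟩
          · exact ⟨h1, by omega⟩
      have h1 := colWt_succ_of_mem (u := u) hl
      rw [hf, Finset.sum_insert (by simp), mul_add, ih]
      simp only at h1
      rw [h1]
      have := colWt_ne_zero hu S m
      field_simp
      ring
    · have h1 := colWt_succ_of_notMem (u := u) hl
      simp only at h1
      rw [h1, ← ih]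
      congr 2
      ext c
      simp only [Finset.mem_filter, and_congr_right_iff]
      intro hc
      have : (c : ℕ) ≠ m := fun h => hl ((Fin.ext h : c = ⟨m, hm⟩) ▸ hc)
      omega

theorem rowMinor_cons_eq_sum_mul [CharZero K] (hx : IsQuantumMatrix u x) {i : Fin n}
    {w : List (Fin n)}
    (hw : ∀ r ∈ w, i < r) (S : Finset (Fin n)) :
    rowMinor u x (i :: w) S =
      ∑ p ∈ S, (colWt u S p)⁻¹ • (rowMinor u x w (S.erase p) * x i p) := by
  have hu := hx.ne_zero
  have hterm : ∀ p ∈ S, (colWt u S p)⁻¹ • (rowMinor u x w (S.erase p) * x i p) =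
      (colWt u S p)⁻¹ • (x i p * rowMinor u x w (S.erase p)) -
      ∑ s ∈ S.filter (fun s => p < s), ((u⁻¹ ^ 2 - 1) * ((colWt u S p)⁻¹ ^ 2 * colWt u S s)) •
        (x i s * rowMinor u x w (S.erase s)) := by
    intro p hp
    have hf : (S.erase p).filter (fun s => p < s) = S.filter fun s => p < s := by
      ext c; simp only [Finset.mem_filter, Finset.mem_erase]; grind
    rw [hx.rowMinor_mul_of_notMem hw (S.notMem_erase p),
      tailMinor_succ_insert hu _ _ _ (S.notMem_erase p), smul_sub, hf, Finset.smul_sum,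
      Finset.smul_sum]
    congr 1
    refine Finset.sum_congr rfl fun s hs => ?_
    obtain ⟨hsS, hps⟩ := Finset.mem_filter.mp hs
    rw [Finset.erase_right_comm, Finset.insert_erase (Finset.mem_erase.mpr ⟨hps.ne, hp⟩),
      colWt_erase_of_lt hu hp hps, colWt_erase_of_le u hp le_rfl, smul_smul, smul_smul]
    congr 1
    field_simp
  rw [Finset.sum_congr rfl hterm, Finset.sum_sub_distrib,
    Finset.sum_comm' (t' := S) (s' := fun s => S.filter fun p => p < s)
      (by simp only [Finset.mem_filter]; grind), ← Finset.sum_sub_distrib, rowMinor]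
  refine Finset.sum_congr rfl fun s _ => ?_
  simp only [Fin.lt_def]
  rw [← Finset.sum_smul, ← sub_smul, ← Finset.mul_sum, ← Finset.sum_mul, ← mul_assoc,
    sum_colWt_inv_sq hu S s.2.le]
  congr 1
  have := colWt_ne_zero hu S s
  field_simp
  ring

end IsQuantumMatrix

variable {u : K} {x : Fin n → Fin n → O}

/-- The `ℤ[q]`-submodule generated by a set. -/
def zqSpan (q : K) (s : Set O) : Submodule (Subring.closure {q}) O :=
  Submodule.span _ s

theorem zqSpan_smul_mem {q c : K} (hc : c ∈ Subring.closure {q}) {s : Set O} {v : O}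
    (hv : v ∈ zqSpan q s) : c • v ∈ zqSpan q s :=
  (zqSpan q s).smul_mem ⟨c, hc⟩ hv

theorem zqSpan_map_mem {O' : Type*} [Ring O'] [Algebra K O'] {q : K} {s : Set O} {t : Set O'}
    (f : O →ₗ[K] O')
    (h : ∀ v ∈ s, f v ∈ zqSpan q t) {v : O} (hv : v ∈ zqSpan q s) : f v ∈ zqSpan q t := by
  induction hv using Submodule.span_induction with
  | mem v hv => exact h v hv
  | zero => rw [map_zero]; exact zero_mem _
  | add v w _ _ hv hw => rw [map_add]; exact add_mem hv hw
  | smul c v _ hv =>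
    rw [show c • v = (c : K) • v from rfl, map_smul]
    exact zqSpan_smul_mem c.2 hv

theorem mem_closure_self (q : K) : q ∈ Subring.closure {q} := Subring.subset_closure rfl

/-- The ordered product of the divided entries `q ^ (a l) ^ 2 • x i l ^ a l` of the row `i` over
the columns of index at least `m`. -/
def rowMon (q : K) (x : Fin n → Fin n → O) (i : Fin n) (a : Fin n → ℕ) (m : ℕ) : O :=
  (((List.finRange n).drop m).map fun l => q ^ (a l) ^ 2 • x i l ^ a l).prod

/-- The sum of the entries of `a` of index at least `m`. -/
def dropSum (a : Fin n → ℕ) (m : ℕ) : ℕ :=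
  (((List.finRange n).drop m).map a).sum

theorem finRange_drop_eq_cons (l : Fin n) :
    (List.finRange n).drop l = l :: (List.finRange n).drop (l + 1) := by
  rw [List.drop_eq_getElem_cons (by simp)]
  simp

theorem mem_finRange_drop {m : ℕ} {l : Fin n} : l ∈ (List.finRange n).drop m ↔ m ≤ l := by
  rw [List.mem_drop_iff_getElem]
  simp only [List.getElem_finRange, List.length_finRange]
  constructor
  · rintro ⟨j, hj, rfl⟩
    simp
  · intro h
    exact ⟨l - m, by omega, by ext; simp; omega⟩

theorem rowMon_self (q : K) (x : Fin n → Fin n → O) (i : Fin n) (a : Fin n → ℕ) :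
    rowMon q x i a n = 1 := by
  rw [rowMon, List.drop_of_length_le (by simp), List.map_nil, List.prod_nil]

theorem rowMon_eq_mul (q : K) (x : Fin n → Fin n → O) (i : Fin n) (a : Fin n → ℕ) (l : Fin n) :
    rowMon q x i a l = (q ^ (a l) ^ 2 • x i l ^ a l) * rowMon q x i a (l + 1) := by
  rw [rowMon, finRange_drop_eq_cons, List.map_cons, List.prod_cons, rowMon]

theorem rowMon_congr (q : K) (x : Fin n → Fin n → O) (i : Fin n) {a b : Fin n → ℕ} {m : ℕ}
    (h : ∀ l : Fin n, m ≤ l → a l = b l) : rowMon q x i a m = rowMon q x i b m := by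
  rw [rowMon, rowMon]
  congr 1
  refine List.map_congr_left fun l hl => ?_
  rw [h l (mem_finRange_drop.mp hl)]

theorem dropSum_eq_add (a : Fin n → ℕ) (l : Fin n) :
    dropSum a l = a l + dropSum a (l + 1) := by
  rw [dropSum, finRange_drop_eq_cons, List.map_cons, List.sum_cons, dropSum]

theorem dropSum_self (a : Fin n → ℕ) : dropSum a n = 0 := by
  rw [dropSum, List.drop_of_length_le (by simp), List.map_nil, List.sum_nil]

theorem dropSum_congr {a b : Fin n → ℕ} {m : ℕ}
    (h : ∀ l : Fin n, m ≤ l → a l = b l) : dropSum a m = dropSum b m := by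
  rw [dropSum, dropSum]
  congr 1
  exact List.map_congr_left fun l hl => h l (mem_finRange_drop.mp hl)

theorem dropSum_zero (a : Fin n → ℕ) : dropSum a 0 = ∑ l, a l := by
  rw [dropSum, List.drop_zero, ← List.ofFn_eq_map, List.sum_ofFn]

/-- The terms `rowMon b * rowMinor T` occurring when a minor with column set `S` is moved past
`rowMon a`. -/
def exchangeTerms (q u : K) (x : Fin n → Fin n → O) (i : Fin n) (w : List (Fin n)) (m : ℕ)
    (a : Fin n → ℕ) (S : Finset (Fin n)) (d : ℕ) : Set O :=
  {v | ∃ (b : Fin n → ℕ) (T : Finset (Fin n)),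
    (∀ l, (b l + if l ∈ T then 1 else 0) = a l + if l ∈ S then 1 else 0) ∧
    (∀ l : Fin n, (l : ℕ) < m → b l = a l) ∧ ∑ l, b l = ∑ l, a l + d ∧
    v = rowMon q x i b m * rowMinor u x w T}

theorem mul_mem_exchangeTerms {q : K} {i : Fin n} {w : List (Fin n)} {l : Fin n}
    {a a' : Fin n → ℕ} {S S' : Finset (Fin n)} {d d' : ℕ} {v : O}
    (hv : v ∈ zqSpan q (exchangeTerms q u x i w (l + 1) a' S' d'))
    (h1 : ∀ c, (a' c + if c ∈ S' then 1 else 0) = a c + if c ∈ S then 1 else 0)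
    (h2 : ∀ c, c < l → a' c = a c) (h3 : ∑ c, a' c + d' = ∑ c, a c + d) :
    (q ^ (a' l) ^ 2 • x i l ^ a' l) * v ∈ zqSpan q (exchangeTerms q u x i w l a S d) := by
  refine zqSpan_map_mem (LinearMap.mulLeft K (q ^ (a' l) ^ 2 • x i l ^ a' l)) ?_ hv
  rintro _ ⟨b, T, hb1, hb2, hb3, rfl⟩
  refine Submodule.subset_span ⟨b, T, fun c => (hb1 c).trans (h1 c),
    fun c hc => (hb2 c (by omega)).trans (h2 c hc), by omega, ?_⟩
  rw [LinearMap.mulLeft_apply, ← mul_assoc, ← hb2 l (by omega), ← rowMon_eq_mul]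

namespace IsQuantumMatrix

theorem exchange_aux [CharZero K] (hx : IsQuantumMatrix u x) {q : K} (hq : u = -q ^ 2) {i : Fin n}
    {w : List (Fin n)} (hw : ∀ r ∈ w, i < r) {m : ℕ} (hm : m ≤ n) (a : Fin n → ℕ)
    (S : Finset (Fin n)) :
    q ^ (2 * dropSum a m) • (rowMinor u x w S * rowMon q x i a m) ∈
        zqSpan q (exchangeTerms q u x i w m a S 0) ∧
      q ^ (2 * dropSum a m + 1) • (tailMinor u x i w m S * rowMon q x i a m) ∈
        zqSpan q (exchangeTerms q u x i w m a S 1) := by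
  have hu := hx.ne_zero
  have hq0 : q ≠ 0 := by rintro rfl; simp [hq] at hu
  have hinv : -u⁻¹ = (q ^ 2)⁻¹ := by rw [hq, inv_neg, neg_neg]
  have hinv2 : u⁻¹ ^ 2 = (q ^ 4)⁻¹ := by rw [hq]; field_simp
  induction hk : n - m generalizing m a S with
  | zero =>
    obtain rfl : m = n := by omega
    rw [tailMinor_eq_zero, zero_mul, smul_zero, dropSum_self, mul_zero, pow_zero, one_smul,
      rowMon_self, mul_one]
    refine ⟨Submodule.subset_span ⟨a, S, fun _ => rfl, fun _ _ => rfl, rfl, ?_⟩, zero_mem _⟩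
    rw [rowMon_self, one_mul]
  | succ k ih =>
    obtain ⟨l, rfl⟩ : ∃ l : Fin n, m = l := ⟨⟨m, by omega⟩, rfl⟩
    replace ih := fun a S => ih (m := l + 1) (by omega) a S (by omega)
    rw [dropSum_eq_add, rowMon_eq_mul]
    set e := dropSum a (l + 1) with he
    by_cases hl : l ∈ S
    · constructor
      · have h := mul_mem_exchangeTerms (l := l) (a := a) (S := S) (ih a S).1 (fun _ => rfl)
          (fun _ _ => rfl) rfl
        convert h using 1
        rw [← mul_assoc, mul_smul_comm, mul_pow_of_mul_eq_smul (hx.rowMinor_mul_of_mem hw hl),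
          smul_mul_assoc, smul_mul_assoc, smul_mul_assoc, mul_smul_comm, ← he, mul_assoc, hinv,
          inv_pow, ← pow_mul]
        match_scalars
        field_simp
        ring
      · have hlt : ∀ c, c < l → Function.update a l (a l + 1) c = a c :=
          fun c hc => Function.update_of_ne hc.ne _ _
        have hgt : ∀ c : Fin n, (l : ℕ) + 1 ≤ c → Function.update a l (a l + 1) c = a c :=
          fun c hc => Function.update_of_ne (by rintro rfl; omega) _ _
        have h1 := mul_mem_exchangeTerms (l := l) (a := a) (S := S) (d := 1)
          (ih (Function.update a l (a l + 1)) (S.erase l)).1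
          (fun c => by
            by_cases hc : c = l
            · subst hc; simp [hl]
            · simp [hc])
          hlt (by
            rw [Finset.sum_update_of_mem (Finset.mem_univ l), ← Finset.add_sum_erase _ a
              (Finset.mem_univ l), Finset.sdiff_singleton_eq_erase]; omega)
        rw [dropSum_congr hgt, rowMon_congr q x i hgt, Function.update_self, ← he] at h1
        have h2 := mul_mem_exchangeTerms (l := l) (a := a) (S := S) (ih a S).2 (fun _ => rfl)
          (fun _ _ => rfl) rfl
        have h3 := add_mem h1 (zqSpan_smul_mem (c := -q ^ (2 * a l + 2))
          (neg_mem (pow_mem (mem_closure_self q) _)) h2)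
        convert h3 using 1
        rw [← mul_assoc, mul_smul_comm, (show Commute _ _ from
          hx.tailMinor_mul_of_mem hw hl).pow_right (a l) |>.eq, tailMinor_of_mem hu _ _ _ hl,
          ← he, hq, pow_succ (x i l)]
        simp only [smul_mul_assoc, mul_smul_comm, mul_add, add_mul, mul_assoc]
        match_scalars
        · field_simp
          ring
        · field_simp
          ring
    · constructor
      · have h1 := mul_mem_exchangeTerms (l := l) (a := a) (S := S) (ih a S).1 (fun _ => rfl)
          (fun _ _ => rfl) rfl
        rcases Nat.eq_zero_or_pos (a l) with ha | ha
        · convert h1 using 1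
          simp [ha, ← he]
        have hlt : ∀ c, c < l → Function.update a l (a l - 1) c = a c :=
          fun c hc => Function.update_of_ne hc.ne _ _
        have hgt : ∀ c : Fin n, (l : ℕ) + 1 ≤ c → Function.update a l (a l - 1) c = a c :=
          fun c hc => Function.update_of_ne (by rintro rfl; omega) _ _
        have h2 := mul_mem_exchangeTerms (l := l) (a := a) (S := S) (d := 0)
          (ih (Function.update a l (a l - 1)) (insert l S)).2
          (fun c => by
            by_cases hc : c = l
            · subst hc; simp [hl]; omega
            · simp [hc])
          hlt (by
            rw [Finset.sum_update_of_mem (Finset.mem_univ l), ← Finset.add_sum_erase _ a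
              (Finset.mem_univ l), Finset.sdiff_singleton_eq_erase]; omega)
        rw [dropSum_congr hgt, rowMon_congr q x i hgt, Function.update_self, ← he] at h2
        have h3 := add_mem (zqSpan_smul_mem (c := q ^ (2 * a l))
          (pow_mem (mem_closure_self q) _) h1) (zqSpan_smul_mem (c := 1 - q ^ (4 * a l))
          (sub_mem (one_mem _) (pow_mem (mem_closure_self q) _)) h2)
        convert h3 using 1
        rw [← mul_assoc, mul_smul_comm, hx.rowMinor_mul_pow_of_notMem hw hl, ← he, pow_mul u⁻¹,
          hinv2, inv_pow, ← pow_mul, hq]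
        obtain ⟨c, hc⟩ : ∃ c, a l = c + 1 := ⟨a l - 1, by omega⟩
        rw [hc, Nat.add_sub_cancel]
        simp only [smul_mul_assoc, mul_smul_comm, mul_add, add_mul, mul_assoc]
        match_scalars
        · field_simp
          ring
        · field_simp
          ring
      · have h := mul_mem_exchangeTerms (l := l) (a := a) (S := S) (ih a S).2 (fun _ => rfl)
          (fun _ _ => rfl) rfl
        convert h using 1
        rw [tailMinor_of_notMem _ _ _ _ hl, ← mul_assoc, mul_smul_comm,
          mul_pow_of_mul_eq_smul (hx.tailMinor_succ_mul_of_notMem hw hl),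
          smul_mul_assoc, smul_mul_assoc, smul_mul_assoc, mul_smul_comm, ← he, mul_assoc, hinv,
          inv_pow, ← pow_mul]
        match_scalars
        field_simp
        ring

theorem rowMinor_mul_rowMon [CharZero K] (hx : IsQuantumMatrix u x) {q : K} (hq : u = -q ^ 2)
    {i : Fin n}
    {w : List (Fin n)} (hw : ∀ r ∈ w, i < r) {m : ℕ} (hm : m ≤ n) (a : Fin n → ℕ)
    {S : Finset (Fin n)} (hS : ∀ c : Fin n, m ≤ c → c ∈ S) :
    q ^ (2 * dropSum a m) • (rowMinor u x w S * rowMon q x i a m) =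
      rowMon q x i a m * rowMinor u x w S := by
  have hu := hx.ne_zero
  have hq0 : q ≠ 0 := by rintro rfl; simp [hq] at hu
  have hinv : -u⁻¹ = (q ^ 2)⁻¹ := by rw [hq, inv_neg, neg_neg]
  induction hk : n - m generalizing m with
  | zero =>
    obtain rfl : m = n := by omega
    rw [dropSum_self, mul_zero, pow_zero, one_smul, rowMon_self, mul_one, one_mul]
  | succ k ih =>
    obtain ⟨l, rfl⟩ : ∃ l : Fin n, m = l := ⟨⟨m, by omega⟩, rfl⟩
    specialize ih (m := l + 1) (by omega) (fun c hc => hS c (by omega)) (by omega)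
    rw [dropSum_eq_add, rowMon_eq_mul, mul_assoc _ _ (rowMinor u x w S), ← ih, ← mul_assoc,
      mul_smul_comm, mul_pow_of_mul_eq_smul (hx.rowMinor_mul_of_mem hw (hS l le_rfl)),
      smul_mul_assoc, smul_mul_assoc, smul_mul_assoc, mul_smul_comm, mul_assoc, hinv,
      inv_pow, ← pow_mul]
    match_scalars
    field_simp
    ring

theorem tailMinor_mul_rowMon [CharZero K] (hx : IsQuantumMatrix u x) {q : K} (hq : u = -q ^ 2)
    {i : Fin n}
    {w : List (Fin n)} (hw : ∀ r ∈ w, i < r) {m : ℕ} (hm : m ≤ i) (a : Fin n → ℕ)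
    {S : Finset (Fin n)} (hS : ∀ c, c ∈ S ↔ i ≤ c) :
    ∃ g ∈ zqSpan q (exchangeTerms q u x i w m a S 1),
      q ^ (2 * dropSum a m + 1) • (tailMinor u x i w m S * rowMon q x i a m) =
        rowMon q x i (Function.update a i (a i + 1)) m * rowMinor u x w (S.erase i) + q • g := by
  have hu := hx.ne_zero
  have hq0 : q ≠ 0 := by rintro rfl; simp [hq] at hu
  have hinv : -u⁻¹ = (q ^ 2)⁻¹ := by rw [hq, inv_neg, neg_neg]
  have hiS : i ∈ S := (hS i).mpr le_rfl
  induction hk : (i : ℕ) - m generalizing m with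
  | zero =>
    obtain rfl : m = i := by omega
    have hgt : ∀ c : Fin n, (i : ℕ) + 1 ≤ c → Function.update a i (a i + 1) c = a c :=
      fun c hc => Function.update_of_ne (by rintro rfl; omega) _ _
    have h := mul_mem_exchangeTerms (l := i) (a := a) (S := S)
      (hx.exchange_aux hq hw i.2 a S).2 (fun _ => rfl) (fun _ _ => rfl) rfl
    refine ⟨_, zqSpan_smul_mem (c := -q ^ (2 * a i + 1))
          (neg_mem (pow_mem (mem_closure_self q) _)) h, ?_⟩
    have hlead := hx.rowMinor_mul_rowMon hq hw i.2 a (S := S.erase i) fun c hc =>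
      Finset.mem_erase.mpr ⟨by rintro rfl; omega, (hS c).mpr (Fin.le_def.mpr (by omega))⟩
    rw [rowMon_eq_mul q x i (Function.update a i (a i + 1)), rowMon_congr q x i hgt,
      Function.update_self, mul_assoc _ _ (rowMinor u x w (S.erase i)), ← hlead, dropSum_eq_add,
      rowMon_eq_mul, ← mul_assoc, mul_smul_comm, (show Commute _ _ from
          hx.tailMinor_mul_of_mem hw hiS).pow_right (a i) |>.eq, tailMinor_of_mem hu _ _ _ hiS,
      hq, pow_succ (x i i)]
    simp only [smul_mul_assoc, mul_smul_comm, mul_add, add_mul, mul_assoc]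
    match_scalars
    · field_simp
      ring
    · field_simp
      ring
  | succ k ih =>
    obtain ⟨l, rfl⟩ : ∃ l : Fin n, m = l := ⟨⟨m, by omega⟩, rfl⟩
    have hli : l ≠ i := by rintro rfl; omega
    have hl : l ∉ S := by rw [hS, Fin.le_def]; omega
    obtain ⟨g, hg, hgeq⟩ := ih (m := l + 1) (by omega) (by omega)
    refine ⟨_, mul_mem_exchangeTerms (l := l) (a := a) (S := S) hg (fun _ => rfl)
      (fun _ _ => rfl) rfl, ?_⟩
    rw [dropSum_eq_add, rowMon_eq_mul, rowMon_eq_mul q x i (Function.update a i (a i + 1)),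
      Function.update_of_ne hli, mul_assoc _ _ (rowMinor u x w (S.erase i)), ← mul_smul_comm q,
      ← mul_add, ← hgeq, tailMinor_of_notMem _ _ _ _ hl, ← mul_assoc, mul_smul_comm,
      mul_pow_of_mul_eq_smul (hx.tailMinor_succ_mul_of_notMem hw hl),
      smul_mul_assoc, smul_mul_assoc, smul_mul_assoc, mul_smul_comm, mul_assoc, hinv,
      inv_pow, ← pow_mul]
    match_scalars
    field_simp
    ring

end IsQuantumMatrix

/-- The ordered product of the row monomials of `A` over the rows of index at least `m`. -/
def matMon (q : K) (x : Fin n → Fin n → O) (A : Matrix (Fin n) (Fin n) ℕ) (m : ℕ) : O :=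
  (((List.finRange n).drop m).map fun i => rowMon q x i (A i) 0).prod

theorem matMon_self (q : K) (x : Fin n → Fin n → O) (A : Matrix (Fin n) (Fin n) ℕ) :
    matMon q x A n = 1 := by
  rw [matMon, List.drop_of_length_le (by simp), List.map_nil, List.prod_nil]

theorem matMon_eq_mul (q : K) (x : Fin n → Fin n → O) (A : Matrix (Fin n) (Fin n) ℕ)
    (i : Fin n) : matMon q x A i = rowMon q x i (A i) 0 * matMon q x A (i + 1) := by
  rw [matMon, finRange_drop_eq_cons, List.map_cons, List.prod_cons, matMon]

theorem matMon_congr (q : K) (x : Fin n → Fin n → O) {A B : Matrix (Fin n) (Fin n) ℕ} {m : ℕ}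
    (h : ∀ i : Fin n, m ≤ i → A i = B i) : matMon q x A m = matMon q x B m := by
  rw [matMon, matMon]
  congr 1
  refine List.map_congr_left fun i hi => ?_
  rw [h i (mem_finRange_drop.mp hi)]

/-- The monomials in the rows of index at least `m` whose row sums exceed those of `A` by one
and whose column sums exceed those of `A` by the indicator of `S`. -/
def shiftedMons (q : K) (x : Fin n → Fin n → O) (A : Matrix (Fin n) (Fin n) ℕ) (m : ℕ)
    (S : Finset (Fin n)) : Set O :=
  {v | ∃ B : Matrix (Fin n) (Fin n) ℕ,
    (∀ i : Fin n, m ≤ i → ∑ j, B i j = ∑ j, A i j + 1) ∧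
    (∀ j, dropSum (fun i => B i j) m = dropSum (fun i => A i j) m + if j ∈ S then 1 else 0) ∧
    v = matMon q x B m}

theorem mul_mem_shiftedMons {q : K} {i : Fin n} {A : Matrix (Fin n) (Fin n) ℕ} {b : Fin n → ℕ}
    {S T : Finset (Fin n)} {v : O} (hv : v ∈ zqSpan q (shiftedMons q x A (i + 1) T))
    (h1 : ∀ l, (b l + if l ∈ T then 1 else 0) = A i l + if l ∈ S then 1 else 0)
    (h2 : ∑ l, b l = ∑ l, A i l + 1) :
    rowMon q x i b 0 * v ∈ zqSpan q (shiftedMons q x A i S) := by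
  refine zqSpan_map_mem (LinearMap.mulLeft K (rowMon q x i b 0)) ?_ hv
  rintro _ ⟨B, hB1, hB2, rfl⟩
  have hgt : ∀ c : Fin n, (i : ℕ) + 1 ≤ c → B.updateRow i b c = B c :=
      fun c hc => Matrix.updateRow_ne (by rintro rfl; omega)
  refine Submodule.subset_span ⟨B.updateRow i b, fun r hr => ?_, fun j => ?_, ?_⟩
  · by_cases h : r = i
    · subst h; rw [Matrix.updateRow_self, h2]
    · rw [Matrix.updateRow_ne h, hB1 r]
      have := Fin.val_ne_of_ne h
      omega
  · have := hB2 j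
    have h := h1 j
    rw [dropSum_eq_add, dropSum_eq_add _ i, Matrix.updateRow_self,
      dropSum_congr (b := fun i => B i j) fun l hl => congrFun (hgt l hl) j]
    omega
  · rw [LinearMap.mulLeft_apply, matMon_eq_mul, Matrix.updateRow_self, matMon_congr q x hgt]

theorem lt_of_mem_drop_succ {i : Fin n} : ∀ r ∈ (List.finRange n).drop (i + 1), i < r :=
  fun _ hr => mem_finRange_drop.mp hr

namespace IsQuantumMatrix

theorem rowMinor_mul_matMon_mem [CharZero K] (hx : IsQuantumMatrix u x) {q : K} (hq : u = -q ^ 2)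
    {m : ℕ}
    (hm : m ≤ n) (A : Matrix (Fin n) (Fin n) ℕ) (S : Finset (Fin n)) :
    q ^ (2 * dropSum (fun i => ∑ j, A i j) m + (n - m)) •
        (rowMinor u x ((List.finRange n).drop m) S * matMon q x A m) ∈
      zqSpan q (shiftedMons q x A m S) := by
  induction hk : n - m generalizing m S with
  | zero =>
    obtain rfl : m = n := by omega
    rw [List.drop_of_length_le (by simp), matMon_self, dropSum_self, rowMinor, mul_one, mul_zero,
      pow_zero, one_smul]
    split_ifs with hS
    · exact Submodule.subset_span ⟨A, fun i hi => by have := i.2; omega, by simp [hS],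
        (matMon_self q x A).symm⟩
    · exact zero_mem _
  | succ k ih =>
    obtain ⟨i, rfl⟩ : ∃ i : Fin n, m = i := ⟨⟨m, by omega⟩, rfl⟩
    replace ih := fun S => ih (m := i + 1) (by omega) S (by omega)
    have h := (hx.exchange_aux hq (i := i) lt_of_mem_drop_succ (Nat.zero_le n) (A i) S).2
    have h2 := zqSpan_map_mem (LinearMap.mulRight K
      (q ^ (2 * dropSum (fun i => ∑ j, A i j) (i + 1) + k) • matMon q x A (i + 1)))
      (t := shiftedMons q x A i S) ?_ h
    · convert h2 using 1
      rw [LinearMap.mulRight_apply, dropSum_eq_add, ← dropSum_zero, matMon_eq_mul,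
        finRange_drop_eq_cons, tailMinor_zero, smul_mul_assoc, mul_smul_comm, mul_assoc, smul_smul]
      congr 1
      ring
    · rintro _ ⟨b, T, hb1, -, hb3, rfl⟩
      rw [LinearMap.mulRight_apply, mul_assoc, mul_smul_comm]
      exact mul_mem_shiftedMons (ih T) hb1 hb3

theorem rowMinor_mul_matMon [CharZero K] (hx : IsQuantumMatrix u x) {q : K} (hq : u = -q ^ 2)
    {m : ℕ}
    (hm : m ≤ n) (A : Matrix (Fin n) (Fin n) ℕ) {S : Finset (Fin n)}
    (hS : ∀ c : Fin n, c ∈ S ↔ m ≤ c) :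
    ∃ g ∈ zqSpan q (shiftedMons q x A m S),
      q ^ (2 * dropSum (fun i => ∑ j, A i j) m + (n - m)) •
        (rowMinor u x ((List.finRange n).drop m) S * matMon q x A m) =
      matMon q x (A + 1) m + q • g := by
  induction hk : n - m generalizing m S with
  | zero =>
    obtain rfl : m = n := by omega
    refine ⟨0, zero_mem _, ?_⟩
    have hS : S = ∅ := Finset.eq_empty_of_forall_notMem fun c hc => by
      have := (hS c).mp hc
      omega
    rw [List.drop_of_length_le (by simp), matMon_self, matMon_self, dropSum_self, rowMinor,
      mul_one, mul_zero, pow_zero, one_smul, if_pos hS, smul_zero, add_zero]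
  | succ k ih =>
    obtain ⟨i, rfl⟩ : ∃ i : Fin n, m = i := ⟨⟨m, by omega⟩, rfl⟩
    have hiS : i ∈ S := (hS i).mpr le_rfl
    obtain ⟨g, hg, hgeq⟩ := ih (m := i + 1) (S := S.erase i) (by omega) (fun c => by
      rw [Finset.mem_erase, hS, ne_eq, Fin.ext_iff]; omega) (by omega)
    obtain ⟨g', hg', hgeq'⟩ := hx.tailMinor_mul_rowMon hq lt_of_mem_drop_succ (m := 0)
      (Nat.zero_le i) (A i) hS
    have h2 := zqSpan_map_mem (LinearMap.mulRight K
      (q ^ (2 * dropSum (fun i => ∑ j, A i j) (i + 1) + k) • matMon q x A (i + 1)))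
      (t := shiftedMons q x A i S) ?_ hg'
    · have hrow : (A + 1) i = Function.update (A i) i (A i i + 1) := by
        ext j
        by_cases h : j = i
        · subst h; simp
        · simp [h, Matrix.one_apply_ne' h]
      refine ⟨_, add_mem (mul_mem_shiftedMons (i := i) (A := A) (S := S)
        (b := Function.update (A i) i (A i i + 1)) hg (fun l => ?_) ?_) h2, ?_⟩
      · by_cases h : l = i
        · subst h; simp [hiS]
        · simp [h]
      · rw [Finset.sum_update_of_mem (Finset.mem_univ i), ← Finset.add_sum_erase _ (A i)
              (Finset.mem_univ i), Finset.sdiff_singleton_eq_erase]; omega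
      have key (P D : O) {c : K} {M M' : O} (h : c • (D * M) = M' + q • g) :
          P * M' + q • (P * g + g' * c • M) = c • ((P * D + q • g') * M) := by
        rw [smul_add, ← mul_smul_comm, ← add_assoc, ← mul_add, ← h, add_mul, smul_add,
          mul_smul_comm, mul_smul_comm, smul_mul_assoc, smul_comm q, mul_assoc]
      rw [matMon_eq_mul q x (A + 1), hrow, LinearMap.mulRight_apply, key _ _ hgeq, ← hgeq',
        dropSum_eq_add, ← dropSum_zero, matMon_eq_mul, finRange_drop_eq_cons, tailMinor_zero,
        smul_mul_assoc, smul_smul, mul_assoc]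
      congr 1
      ring
    · rintro _ ⟨b, T, hb1, -, hb3, rfl⟩
      rw [LinearMap.mulRight_apply, mul_assoc, mul_smul_comm]
      have h := hx.rowMinor_mul_matMon_mem hq i.2 A T
      rw [show n - (i + 1) = k by omega] at h
      exact mul_mem_shiftedMons h hb1 hb3

end IsQuantumMatrix

end QuantumMinors

section Leibniz

variable {K O : Type*} [Field K] [Ring O] [Algebra K O] {n : ℕ}

/-- The permutation with `0 ↦ p` which restricts to `τ` on the remaining indices. -/
def consPerm {m : ℕ} (p : Fin (m + 1)) (τ : Equiv.Perm (Fin m)) : Equiv.Perm (Fin (m + 1)) :=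
  p.cycleRange.symm * Equiv.Perm.decomposeFin.symm (0, τ)

theorem consPerm_zero {m : ℕ} (p : Fin (m + 1)) (τ : Equiv.Perm (Fin m)) :
    consPerm p τ 0 = p := by
  simp [consPerm]

theorem consPerm_succ {m : ℕ} (p : Fin (m + 1)) (τ : Equiv.Perm (Fin m)) (i : Fin m) :
    consPerm p τ i.succ = p.succAbove (τ i) := by
  simp [consPerm]

theorem consPerm_bijective (m : ℕ) :
    Function.Bijective fun a : Fin (m + 1) × Equiv.Perm (Fin m) => consPerm a.1 a.2 := by
  rw [Fintype.bijective_iff_injective_and_card]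
  constructor
  · rintro ⟨p, τ⟩ ⟨p', τ'⟩ h
    have h : consPerm p τ = consPerm p' τ' := h
    have hp : p = p' := by rw [← consPerm_zero p τ, h, consPerm_zero]
    subst hp
    have hτ : τ = τ' := by
      ext i : 1
      have := congrArg (fun σ : Equiv.Perm (Fin (m + 1)) => σ i.succ) h
      simpa only [consPerm_succ, Fin.succAbove_right_inj] using this
    rw [hτ]
  · simp [Fintype.card_perm, Nat.factorial_succ]

theorem invCount_eq_sum {m : ℕ} (σ : Equiv.Perm (Fin m)) :
    invCount σ = ∑ i, ∑ j, if i < j ∧ σ j < σ i then 1 else 0 := by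
  rw [invCount, Finset.card_filter, Fintype.sum_prod_type]

theorem invCount_consPerm {m : ℕ} (p : Fin (m + 1)) (τ : Equiv.Perm (Fin m)) :
    invCount (consPerm p τ) = p + invCount τ := by
  rw [invCount_eq_sum, Fin.sum_univ_succ, invCount_eq_sum]
  congr 1
  · rw [Fin.sum_univ_succ]
    simp only [lt_self_iff_false, false_and, if_false, zero_add, Fin.succ_pos, true_and,
      consPerm_zero, consPerm_succ, Fin.succAbove_lt_iff_castSucc_lt]
    rw [Equiv.sum_comp τ fun j => if j.castSucc < p then 1 else 0, ← Finset.card_filter]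
    simp only [Fin.lt_def, Fin.val_castSucc]
    rw [Fin.card_filter_val_lt]
    omega
  · refine Finset.sum_congr rfl fun i _ => ?_
    rw [Fin.sum_univ_succ]
    simp [consPerm_succ, (Fin.strictMono_succAbove p).lt_iff_lt]

theorem rowMinor_ofFn (u : K) (x : Fin n → Fin n → O) {m : ℕ} (ρ κ : Fin m → Fin n)
    (hκ : StrictMono κ) : rowMinor u x (List.ofFn ρ) (Finset.univ.image κ) =
      ∑ σ : Equiv.Perm (Fin m), u ^ invCount σ • (List.ofFn fun i => x (ρ i) (κ (σ i))).prod := by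
  induction m with
  | zero => simp [rowMinor, invCount]
  | succ m ih =>
    rw [List.ofFn_succ, rowMinor, Finset.sum_image hκ.injective.injOn,
      ← (consPerm_bijective m).sum_comp, Fintype.sum_prod_type]
    refine Finset.sum_congr rfl fun p _ => ?_
    have herase : (Finset.univ.image κ).erase (κ p) = Finset.univ.image (κ ∘ p.succAbove) := by
      ext c
      simp only [Finset.mem_erase, Finset.mem_image, Finset.mem_univ, true_and,
        Function.comp_apply]
      constructor
      · rintro ⟨hc, j, rfl⟩
        obtain ⟨k, rfl⟩ := Fin.exists_succAbove_eq (fun h : j = p => hc (h ▸ rfl))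
        exact ⟨k, rfl⟩
      · rintro ⟨k, rfl⟩
        exact ⟨fun h => Fin.succAbove_ne p k (hκ.injective h), _, rfl⟩
    have hwt : colWt u (Finset.univ.image κ) (κ p) = u ^ (p : ℕ) := by
      rw [colWt]
      simp only [Fin.val_fin_lt]
      rw [Finset.filter_image, Finset.card_image_of_injective _ hκ.injective]
      simp only [hκ.lt_iff_lt, Fin.lt_def]
      rw [Fin.card_filter_val_lt, min_eq_right p.2.le]
    rw [herase, hwt, ih _ _ (hκ.comp (Fin.strictMono_succAbove p)), Finset.mul_sum,
      Finset.smul_sum]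
    refine Finset.sum_congr rfl fun τ _ => ?_
    rw [mul_smul_comm, smul_smul, ← pow_add, invCount_consPerm, List.ofFn_succ, List.prod_cons]
    simp only [consPerm_zero, consPerm_succ, Function.comp_apply]

theorem qDet_eq_rowMinor (n : ℕ) :
    qDet n = rowMinor (-(qq ^ 2)) (xgen n) (List.finRange n) Finset.univ := by
  have h := rowMinor_ofFn (-(qq ^ 2)) (xgen n) id id strictMono_id
  rw [Finset.image_id, List.ofFn_id] at h
  rw [h, qDet]
  simp only [List.ofFn_eq_map, id]

end Leibniz

theorem qq_ne_zero : qq ≠ 0 := RatFunc.X_ne_zero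

theorem xgen_row (n : ℕ) {i j k : Fin n} (h : j < k) :
    xgen n i j * xgen n i k = qq ^ 2 • (xgen n i k * xgen n i j) := by
  have := RingQuot.mkAlgHom_rel Kq (OqRel.rel_row (i := i) h)
  rwa [map_smul, map_mul, map_mul] at this

theorem xgen_col (n : ℕ) {i k j : Fin n} (h : i < k) :
    xgen n i j * xgen n k j = qq ^ 2 • (xgen n k j * xgen n i j) := by
  have := RingQuot.mkAlgHom_rel Kq (OqRel.rel_col (j := j) h)
  rwa [map_smul, map_mul, map_mul] at this

theorem xgen_anti (n : ℕ) {i j s t : Fin n} (h1 : s < i) (h2 : j < t) :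
    xgen n i j * xgen n s t = xgen n s t * xgen n i j := by
  have := RingQuot.mkAlgHom_rel Kq (OqRel.rel_anti h1 h2)
  rwa [map_mul, map_mul] at this

theorem xgen_diag (n : ℕ) {i j s t : Fin n} (h1 : i < s) (h2 : j < t) :
    xgen n i j * xgen n s t = xgen n s t * xgen n i j +
      (qq ^ 2 - qq⁻¹ ^ 2) • (xgen n i t * xgen n s j) := by
  have := RingQuot.mkAlgHom_rel Kq (OqRel.rel_diag h1 h2)
  rwa [map_add, map_smul, map_mul, map_mul, map_mul] at this

theorem neg_qq_sq_ne_zero : -qq ^ 2 ≠ 0 := neg_ne_zero.mpr (pow_ne_zero 2 qq_ne_zero)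

theorem isQuantumMatrix_xgen (n : ℕ) : IsQuantumMatrix (-qq ^ 2) (xgen n) where
  ne_zero := neg_qq_sq_ne_zero
  row h := by
    rw [xgen_row n h, inv_neg, neg_neg, inv_smul_smul₀ (pow_ne_zero 2 qq_ne_zero)]
  col h := by
    rw [xgen_col n h, inv_neg, neg_neg, inv_smul_smul₀ (pow_ne_zero 2 qq_ne_zero)]
  anti h1 h2 := xgen_anti n h1 h2
  diag h1 h2 := by
    rw [xgen_diag n h1 h2, inv_neg, inv_pow,
      show -(qq ^ 2)⁻¹ - -qq ^ 2 = qq ^ 2 - (qq ^ 2)⁻¹ by ring, add_sub_cancel_right]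

/-- Reversing rows, columns and products yields another quantum matrix. -/
theorem isQuantumMatrix_op_rev (n : ℕ) :
    IsQuantumMatrix (-qq ^ 2) fun i j => MulOpposite.op (xgen n i.rev j.rev) where
  ne_zero := neg_qq_sq_ne_zero
  row h := by
    rw [← MulOpposite.op_mul, ← MulOpposite.op_mul, xgen_row n (Fin.rev_lt_rev.mpr h), inv_neg,
      neg_neg, MulOpposite.op_smul, inv_smul_smul₀ (pow_ne_zero 2 qq_ne_zero)]
  col h := by
    rw [← MulOpposite.op_mul, ← MulOpposite.op_mul, xgen_col n (Fin.rev_lt_rev.mpr h), inv_neg,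
      neg_neg, MulOpposite.op_smul, inv_smul_smul₀ (pow_ne_zero 2 qq_ne_zero)]
  anti h1 h2 := by
    rw [← MulOpposite.op_mul, ← MulOpposite.op_mul,
      xgen_anti n (Fin.rev_lt_rev.mpr h1) (Fin.rev_lt_rev.mpr h2)]
  diag h1 h2 := by
    rw [← MulOpposite.op_mul, ← MulOpposite.op_mul, ← MulOpposite.op_mul,
      xgen_diag n (Fin.rev_lt_rev.mpr h1) (Fin.rev_lt_rev.mpr h2), inv_neg, inv_pow,
      show -(qq ^ 2)⁻¹ - -qq ^ 2 = qq ^ 2 - (qq ^ 2)⁻¹ by ring, MulOpposite.op_add,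
      MulOpposite.op_smul, add_sub_cancel_right]

section Lattice

theorem prod_map_smul_smul {ι K O : Type*} [CommSemiring K] [Semiring O] [Algebra K O]
    (l : List ι) (c : ι → K) (f : ι → O) :
    (l.map fun i => c i • f i).prod = (l.map c).prod • (l.map f).prod := by
  induction l with
  | nil => simp
  | cons i l ih => simp only [List.map_cons, List.prod_cons, ih, smul_mul_smul_comm]

theorem prod_map_pow_finRange {n : ℕ} (q : Kq) (e : Fin n → ℕ) :
    ((List.finRange n).map fun i => q ^ e i).prod = q ^ ∑ i, e i := by
  rw [← List.ofFn_eq_map, List.prod_ofFn, Finset.prod_pow_eq_pow_sum]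

theorem matMon_xgen (n : ℕ) (A : Mat n) :
    matMon qq (xgen n) A 0 = qq ^ (∑ i, ∑ j, A i j ^ 2) • xMon n A := by
  simp only [matMon, rowMon, List.drop_zero, prod_map_smul_smul, prod_map_pow_finRange, xMon]

theorem matMon_xgen_eq_smul_xMod (n : ℕ) (A : Mat n) :
    matMon qq (xgen n) A 0 = qq ^ (∑ i, ∑ j, A i j ^ 2 + eExp n A) • xMod n A := by
  rw [matMon_xgen, xMod, smul_smul, pow_add, zpow_neg, zpow_natCast, mul_assoc,
    mul_inv_cancel₀ (pow_ne_zero _ qq_ne_zero), mul_one]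

theorem sum_sq_eq_add_two_mul_sum_lt {n : ℕ} (f : Fin n → ℕ) :
    (∑ j, f j) ^ 2 = ∑ j, f j ^ 2 +
      2 * ∑ j, ∑ k ∈ Finset.univ.filter (fun k => k < j), f j * f k := by
  have h : ∑ j, ∑ k ∈ Finset.univ.filter (fun k => j < k), f j * f k =
      ∑ j, ∑ k ∈ Finset.univ.filter (fun k => k < j), f j * f k := by
    simp only [Finset.sum_filter]
    rw [Finset.sum_comm]
    simp only [mul_comm]
  rw [two_mul]
  nth_rewrite 2 [← h]
  rw [sq, Finset.sum_mul_sum, ← Finset.sum_add_distrib, ← Finset.sum_add_distrib]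
  refine Finset.sum_congr rfl fun j _ => ?_
  rw [← Finset.sum_filter_add_sum_filter_not _ (fun k => k < j), add_comm (∑ k with k < j,
    f j * f k),
    add_comm (∑ k with k < j, f j * f k), ← add_assoc]
  congr 1
  rw [show (Finset.univ.filter fun k => ¬k < j) =
    insert j (Finset.univ.filter fun k => j < k) by
      ext k
      simp only [Finset.mem_filter, Finset.mem_insert, Finset.mem_univ, true_and]
      omega,
    Finset.sum_insert (by simp), sq]

theorem two_mul_sum_sq_add_eExp (n : ℕ) (A : Mat n) :
    2 * (∑ i, ∑ j, A i j ^ 2 + eExp n A) =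
      ∑ i, (∑ j, A i j) ^ 2 + ∑ j, (∑ i, A i j) ^ 2 := by
  simp only [sum_sq_eq_add_two_mul_sum_lt, Finset.sum_add_distrib, eExp,
    ← Finset.mul_sum]
  rw [Finset.sum_comm (f := fun i j => A j i ^ 2)]
  ring

theorem sum_sq_add_eExp_of_shift {n : ℕ} {A B : Mat n}
    (hr : ∀ i, ∑ j, B i j = ∑ j, A i j + 1) (hc : ∀ j, ∑ i, B i j = ∑ i, A i j + 1) :
    ∑ i, ∑ j, B i j ^ 2 + eExp n B =
      2 * ∑ i, ∑ j, A i j + n + (∑ i, ∑ j, A i j ^ 2 + eExp n A) := by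
  have hA := two_mul_sum_sq_add_eExp n A
  have hB := two_mul_sum_sq_add_eExp n B
  simp only [hr, hc, add_sq, Finset.sum_add_distrib, mul_one, one_pow, ← Finset.mul_sum,
    Finset.sum_const, Finset.card_univ, Fintype.card_fin, smul_eq_mul] at hB
  rw [Finset.sum_comm (f := fun j i => A i j)] at hB
  omega

/-- The `ℤ[q]`-lattice generated by the modified monomials. -/
abbrev xLattice (n : ℕ) : Submodule (Subring.closure {qq}) (Oq n) :=
  zqSpan qq (Set.range (xMod n))

/-- A linear map raising `x(A)` to `x(A + 1)` modulo `q` times the lattice. -/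
def IsShift {n : ℕ} (f : Oq n →ₗ[Kq] Oq n) : Prop :=
  ∀ A, ∃ g ∈ xLattice n, f (xMod n A) = xMod n (A + 1) + qq • g

theorem exists_of_matMon {n : ℕ} {f : Oq n →ₗ[Kq] Oq n} {A : Mat n}
    (h : ∃ g ∈ zqSpan qq (shiftedMons qq (xgen n) A 0 Finset.univ),
      qq ^ (2 * dropSum (fun i => ∑ j, A i j) 0 + (n - 0)) • f (matMon qq (xgen n) A 0) =
        matMon qq (xgen n) (A + 1) 0 + qq • g) :
    ∃ g ∈ xLattice n, f (xMod n A) = xMod n (A + 1) + qq • g := by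
  obtain ⟨g, hg, h⟩ := h
  set N := 2 * ∑ i, ∑ j, A i j + n + (∑ i, ∑ j, A i j ^ 2 + eExp n A) with hN
  have hN0 : qq ^ N ≠ 0 := pow_ne_zero _ qq_ne_zero
  refine ⟨(qq ^ N)⁻¹ • g, ?_, ?_⟩
  · refine zqSpan_map_mem ((qq ^ N)⁻¹ • LinearMap.id) ?_ hg
    rintro _ ⟨B, hr, hc, rfl⟩
    simp only [dropSum_zero, Finset.mem_univ, if_true] at hc
    rw [matMon_xgen_eq_smul_xMod, sum_sq_add_eExp_of_shift (fun i => hr i (Nat.zero_le _)) hc,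
      LinearMap.smul_apply, LinearMap.id_apply, inv_smul_smul₀ hN0]
    exact Submodule.subset_span ⟨B, rfl⟩
  · rw [matMon_xgen_eq_smul_xMod, matMon_xgen_eq_smul_xMod, map_smul, smul_smul, ← pow_add,
      sum_sq_add_eExp_of_shift (A := A) (B := A + 1), dropSum_zero, Nat.sub_zero, ← hN] at h
    · rw [← inv_smul_smul₀ hN0 (f (xMod n A)), h, smul_add, inv_smul_smul₀ hN0, smul_comm]
    · intro i
      simp [Matrix.add_apply, Finset.sum_add_distrib, Matrix.one_apply]
    · intro j
      simp [Matrix.add_apply, Finset.sum_add_distrib, Matrix.one_apply]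

theorem isShift_mulLeft_qDet (n : ℕ) : IsShift (LinearMap.mulLeft Kq (qDet n)) := fun A =>
  exists_of_matMon (by
    rw [qDet_eq_rowMinor]
    exact (isQuantumMatrix_xgen n).rowMinor_mul_matMon rfl (Nat.zero_le n) A (by simp))

end Lattice

section RightMultiplication

theorem unop_prod_map_finRange {M : Type*} [Monoid M] {n : ℕ} (f : Fin n → Mᵐᵒᵖ) :
    ((List.finRange n).map f).prod.unop = ((List.finRange n).map fun i => (f i.rev).unop).prod := by
  rw [MulOpposite.unop_list_prod, List.map_map, ← List.map_reverse, List.finRange_reverse,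
    List.map_map]
  rfl

theorem sum_rev {n : ℕ} (f : Fin n → ℕ) : ∑ i, f (Fin.rev i) = ∑ i, f i :=
  Equiv.sum_comp Fin.revPerm f

theorem unop_matMon (n : ℕ) (B : Mat n) :
    (matMon qq (fun i j => MulOpposite.op (xgen n i.rev j.rev)) B 0).unop =
      matMon qq (xgen n) (B.submatrix Fin.rev Fin.rev) 0 := by
  simp only [matMon, rowMon, List.drop_zero, unop_prod_map_finRange, MulOpposite.unop_smul,
    MulOpposite.unop_pow, MulOpposite.unop_op, Fin.rev_rev, Matrix.submatrix_apply]

theorem invCount_rev_conj {n : ℕ} (σ : Equiv.Perm (Fin n)) :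
    invCount (Fin.revPerm * σ * Fin.revPerm) = invCount σ := by
  rw [invCount_eq_sum, invCount_eq_sum, ← sum_rev, Finset.sum_comm, ← sum_rev]
  simp only [Equiv.Perm.mul_apply, Fin.revPerm_apply, Fin.rev_rev, Fin.rev_lt_rev]

theorem unop_rowMinor (n : ℕ) :
    (rowMinor (-qq ^ 2) (fun i j => MulOpposite.op (xgen n i.rev j.rev)) (List.finRange n)
      Finset.univ).unop = qDet n := by
  have h := rowMinor_ofFn (-qq ^ 2) (fun i j => MulOpposite.op (xgen n (Fin.rev i) (Fin.rev j)))
    id id strictMono_id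
  rw [Finset.image_id, List.ofFn_id] at h
  rw [h, Finset.unop_sum, qDet, ← ((Equiv.mulLeft Fin.revPerm).trans
    (Equiv.mulRight Fin.revPerm)).sum_comp]
  refine Finset.sum_congr rfl fun σ _ => ?_
  rw [Equiv.trans_apply, Equiv.coe_mulLeft, Equiv.coe_mulRight, invCount_rev_conj,
    MulOpposite.unop_smul, List.ofFn_eq_map, unop_prod_map_finRange]
  simp only [MulOpposite.unop_op, id, Fin.rev_rev, Equiv.Perm.mul_apply, Fin.revPerm_apply]

theorem isShift_mulRight_qDet (n : ℕ) : IsShift (LinearMap.mulRight Kq (qDet n)) := fun A =>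
  exists_of_matMon (by
    obtain ⟨g, hg, h⟩ := (isQuantumMatrix_op_rev n).rowMinor_mul_matMon rfl (Nat.zero_le n)
      (A.submatrix Fin.rev Fin.rev) (S := Finset.univ) (by simp)
    refine ⟨g.unop, ?_, ?_⟩
    · refine zqSpan_map_mem (MulOpposite.opLinearEquiv Kq).symm.toLinearMap ?_ hg
      rintro _ ⟨B, hr, hc, rfl⟩
      refine Submodule.subset_span ⟨B.submatrix Fin.rev Fin.rev, fun i _ => ?_, fun j => ?_,
        unop_matMon n B⟩
      · have := hr i.rev (Nat.zero_le _)
        simp only [Matrix.submatrix_apply] at this ⊢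
        rw [sum_rev (B i.rev), this, Fin.rev_rev, sum_rev (A i)]
      · have := hc j.rev
        simp only [Matrix.submatrix_apply, dropSum_zero, Finset.mem_univ, if_true] at this ⊢
        rw [sum_rev fun i => B i j.rev, this, Fin.rev_rev, sum_rev fun i => A i j]
    · have h := congrArg MulOpposite.unop h
      rw [MulOpposite.unop_smul, MulOpposite.unop_mul, MulOpposite.unop_add, unop_matMon,
        unop_matMon, List.drop_zero, unop_rowMinor, MulOpposite.unop_smul] at h
      have hsum : ∑ i, ∑ j, A (Fin.rev i) (Fin.rev j) = ∑ i, ∑ j, A i j := by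
        rw [sum_rev fun i => ∑ j, A i (Fin.rev j)]
        exact Finset.sum_congr rfl fun i _ => sum_rev (A i)
      have hA : (A.submatrix Fin.rev Fin.rev).submatrix Fin.rev Fin.rev = A := by
        ext i j; simp
      have hA1 : (A.submatrix Fin.rev Fin.rev + 1).submatrix Fin.rev Fin.rev = A + 1 := by
        ext i j; simp [Matrix.one_apply]
      simp only [dropSum_zero, Matrix.submatrix_apply, hsum, hA, hA1] at h
      rw [dropSum_zero]
      exact h)

end RightMultiplication

section Bar

open Polynomial

variable {n : ℕ} {bar : Oq n → Oq n}

namespace IsBar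

theorem map_zero (hbar : IsBar n bar) : bar 0 = 0 := by
  have h := hbar.2.1 0 0
  rwa [add_zero, left_eq_add] at h

theorem map_sum (hbar : IsBar n bar) {ι : Type*} (s : Finset ι) (f : ι → Oq n) :
    bar (∑ i ∈ s, f i) = ∑ i ∈ s, bar (f i) :=
  _root_.map_sum ({ toFun := bar, map_zero' := hbar.map_zero, map_add' := hbar.2.1 } :
    Oq n →+ Oq n) f s

theorem map_neg (hbar : IsBar n bar) (a : Oq n) : bar (-a) = -bar a :=
  _root_.map_neg ({ toFun := bar, map_zero' := hbar.map_zero, map_add' := hbar.2.1 } :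
    Oq n →+ Oq n) a

theorem map_aeval_smul (hbar : IsBar n bar) (P : ℤ[X]) (a : Oq n) :
    bar (aeval qq P • a) = aeval qq⁻¹ P • bar a := by
  have hpow (k : ℕ) (a : Oq n) : bar (qq ^ k • a) = qq⁻¹ ^ k • bar a := by
    induction k generalizing a with
    | zero => rw [pow_zero, pow_zero, one_smul, one_smul]
    | succ k ih => rw [pow_succ, mul_smul, ih, hbar.2.2.2.2.2.2, smul_smul, ← pow_succ]
  induction P using Polynomial.induction_on' with
  | add P Q hP hQ => rw [map_add, map_add, add_smul, add_smul, hbar.2.1, hP, hQ]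
  | monomial k c =>
    have hc := hbar.2.2.1 (c : ℚ) (qq ^ k • a)
    rw [Rat.cast_intCast, hpow] at hc
    rw [aeval_monomial, aeval_monomial, eq_intCast, mul_smul, mul_smul, hc]

theorem map_rowMinor (hbar : IsBar n bar) {w : List (Fin n)} (hw : w.Pairwise (· < ·))
    (S : Finset (Fin n)) :
    bar (rowMinor (-qq ^ 2) (xgen n) w S) = rowMinor (-qq ^ 2) (xgen n) w S := by
  induction w generalizing S with
  | nil =>
    simp only [rowMinor]
    split_ifs
    · exact hbar.2.2.2.2.1
    · exact hbar.map_zero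
  | cons i w ih =>
    rw [List.pairwise_cons] at hw
    conv_rhs => rw [(isQuantumMatrix_xgen n).rowMinor_cons_eq_sum_mul hw.1]
    rw [rowMinor, hbar.map_sum]
    refine Finset.sum_congr rfl fun p _ => ?_
    have h := hbar.map_aeval_smul ((-X ^ 2) ^ (S.filter fun c : Fin n => (c : ℕ) < p).card)
      (xgen n i p * rowMinor (-qq ^ 2) (xgen n) w (S.erase p))
    simp only [map_pow, _root_.map_neg, aeval_X] at h
    rw [colWt, h, hbar.2.2.2.1, ih hw.2, hbar.2.2.2.2.2.1, ← inv_pow, inv_neg, inv_pow]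

theorem map_qDet (hbar : IsBar n bar) : bar (qDet n) = qDet n := by
  rw [qDet_eq_rowMinor]
  exact hbar.map_rowMinor (List.pairwise_lt_finRange n) _

end IsBar

theorem exists_aeval_of_inZq {c : Kq} (hc : inZq c) : ∃ P : ℤ[X], aeval qq P = c := by
  induction hc using Subring.closure_induction with
  | mem c hc => exact ⟨X, by rw [aeval_X, Set.mem_singleton_iff.mp hc]⟩
  | zero => exact ⟨0, map_zero _⟩
  | one => exact ⟨1, map_one _⟩
  | add c d _ _ hc hd =>
    obtain ⟨⟨P, rfl⟩, Q, rfl⟩ := hc, hd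
    exact ⟨P + Q, map_add _ _ _⟩
  | neg c _ hc =>
    obtain ⟨P, rfl⟩ := hc
    exact ⟨-P, map_neg _ _⟩
  | mul c d _ _ hc hd =>
    obtain ⟨⟨P, rfl⟩, Q, rfl⟩ := hc, hd
    exact ⟨P * Q, map_mul _ _ _⟩

theorem inZq_aeval (P : ℤ[X]) : inZq (aeval qq P) := by
  induction P using Polynomial.induction_on' with
  | add P Q hP hQ => rw [map_add]; exact add_mem hP hQ
  | monomial k c =>
    rw [aeval_monomial, eq_intCast]
    exact mul_mem (intCast_mem _ c) (pow_mem (mem_closure_self qq) k)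

theorem aeval_qq_injective : Function.Injective (aeval qq : ℤ[X] →ₐ[ℤ] Kq) := by
  have h (P : ℤ[X]) :
      aeval qq P = algebraMap ℚ[X] (RatFunc ℚ) (P.map (Int.castRingHom ℚ)) := by
    induction P using Polynomial.induction_on' with
    | add P Q hP hQ => rw [map_add, hP, hQ, Polynomial.map_add, map_add]
    | monomial k c =>
      rw [aeval_monomial, eq_intCast, map_monomial, eq_intCast, ← C_mul_X_pow_eq_monomial,
        map_mul, map_pow, RatFunc.algebraMap_X, qq, map_intCast, map_intCast]
  intro P Q hPQ
  rw [h, h] at hPQ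
  exact map_injective _ (RingHom.injective_int _) (RatFunc.algebraMap_injective ℚ hPQ)

theorem memLstar_of_mem_xLattice {g : Oq n} (hg : g ∈ xLattice n) : memLstar n g := by
  obtain ⟨c, rfl⟩ := (Finsupp.mem_span_range_iff_exists_finsupp).mp hg
  exact ⟨c.support, fun A => c A, fun A _ => (c A).2, rfl⟩

theorem pow_mul_aeval_inv_eq {P : ℤ[X]} {N : ℕ} (h : P.natDegree ≤ N) :
    qq ^ N * aeval qq⁻¹ P = aeval qq (P.reflect N) := by
  let : Invertible qq⁻¹ := invertibleOfNonzero (inv_ne_zero qq_ne_zero)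
  have h' := eval₂_reflect_mul_pow (algebraMap ℤ Kq) qq⁻¹ N P h
  rw [invOf_eq_inv, inv_inv, ← aeval_def, ← aeval_def] at h'
  rw [← h', mul_left_comm, ← mul_pow, mul_inv_cancel₀ qq_ne_zero, one_pow, mul_one]

namespace IsDCB

variable {b : Mat n → Oq n}

theorem exists_eq_sum_aeval (hb : IsDCB n bar b) {g : Oq n} (hg : g ∈ xLattice n) :
    ∃ (F : Finset (Mat n)) (P : Mat n → ℤ[X]), (∀ A ∉ F, P A = 0) ∧
      g = ∑ A ∈ F, aeval qq (P A) • b A := by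
  classical
  obtain ⟨F, h, hh, rfl⟩ := hb.2.2.1 g (memLstar_of_mem_xLattice hg)
  choose! P hP using fun A hA => exists_aeval_of_inZq (hh A hA)
  refine ⟨F, fun A => if A ∈ F then P A else 0, fun A hA => if_neg hA,
    Finset.sum_congr rfl fun A hA => ?_⟩
  simp only [if_pos hA, hP A hA]

theorem eq_zero_of_bar_eq (hbar : IsBar n bar) (hb : IsDCB n bar b) {g₁ g₂ : Oq n}
    (hg₁ : g₁ ∈ xLattice n) (hg₂ : g₂ ∈ xLattice n) (h : bar (qq • g₁) = qq • g₂) : g₂ = 0 := by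
  classical
  obtain ⟨F₁, P, hP, rfl⟩ := hb.exists_eq_sum_aeval hg₁
  obtain ⟨F₂, Q, hQ, rfl⟩ := hb.exists_eq_sum_aeval hg₂
  set F := F₁ ∪ F₂
  set N := F.sup fun A => (P A).natDegree
  rw [Finset.sum_subset (Finset.subset_union_left : F₁ ⊆ F)
      fun A _ hA => by rw [hP A hA, map_zero, zero_smul],
    Finset.sum_subset (Finset.subset_union_right : F₂ ⊆ F)
      fun A _ hA => by rw [hQ A hA, map_zero, zero_smul]] at h
  rw [Finset.sum_subset (Finset.subset_union_right : F₂ ⊆ F)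
      fun A _ hA => by rw [hQ A hA, map_zero, zero_smul]]
  have hN : ∀ A ∈ F, (P A).natDegree ≤ N := fun A hA =>
    Finset.le_sup (f := fun A => (P A).natDegree) hA
  have key : ∑ A ∈ F, aeval qq ((P A).reflect N - X ^ (N + 2) * Q A) • b A = 0 := by
    have h' := congrArg (fun v => qq ^ (N + 1) • v) h
    simp only [hbar.2.2.2.2.2.2, hbar.map_sum, hbar.map_aeval_smul, hb.1, Finset.smul_sum] at h'
    rw [← sub_eq_zero, ← Finset.sum_sub_distrib] at h'
    rw [← h']
    refine Finset.sum_congr rfl fun A hA => ?_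
    rw [smul_smul, smul_smul, smul_smul, smul_smul, ← sub_smul, map_sub, map_mul, map_pow,
      aeval_X, ← pow_mul_aeval_inv_eq (hN A hA)]
    have := qq_ne_zero
    congr 1
    generalize aeval qq⁻¹ (P A) = y
    field_simp
    ring
  refine Finset.sum_eq_zero fun A hA => ?_
  have hA0 := hb.2.2.2 F _ (fun A _ => inZq_aeval _) key A hA
  have hPQ : (P A).reflect N = X ^ (N + 2) * Q A :=
    sub_eq_zero.mp (aeval_qq_injective (hA0.trans (map_zero _).symm))
  have hQ0 : Q A = 0 := by
    ext k
    rw [← coeff_X_pow_mul _ (N + 2) k, ← hPQ, coeff_reflect, revAt_eq_self_of_lt (by omega),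
      coeff_zero]
    exact coeff_eq_zero_of_natDegree_lt ((hN A hA).trans_lt (by omega))
  rw [hQ0, map_zero, zero_smul]

theorem exists_eq_xMod_add (hb : IsDCB n bar b) (A : Mat n) :
    ∃ g ∈ xLattice n, b A = xMod n A + qq • g := by
  obtain ⟨F, h, hh, hA⟩ := hb.2.1 A
  choose! d hd hhd using fun B hB => (hh B hB).2
  refine ⟨∑ B ∈ F, d B • xMod n B, sum_mem fun B hB => zqSpan_smul_mem (hd B hB)
    (Submodule.subset_span ⟨B, rfl⟩), ?_⟩
  rw [hA, Finset.smul_sum]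
  congr 1
  exact Finset.sum_congr rfl fun B hB => by rw [smul_smul, ← hhd B hB]

end IsDCB

theorem IsShift.map_mem {f : Oq n →ₗ[Kq] Oq n} (hf : IsShift f) {g : Oq n}
    (hg : g ∈ xLattice n) : f g ∈ xLattice n := by
  refine zqSpan_map_mem f ?_ hg
  rintro _ ⟨A, rfl⟩
  obtain ⟨g, hg, h⟩ := hf A
  rw [h]
  exact add_mem (Submodule.subset_span ⟨_, rfl⟩) (zqSpan_smul_mem (mem_closure_self qq) hg)

theorem IsShift.exists_map_eq {f : Oq n →ₗ[Kq] Oq n} (hf : IsShift f) {b : Mat n → Oq n}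
    (hb : IsDCB n bar b) (A : Mat n) :
    ∃ g ∈ xLattice n, f (b A) - b (A + 1) = qq • g := by
  obtain ⟨g₁, hg₁, h₁⟩ := hb.exists_eq_xMod_add A
  obtain ⟨g₂, hg₂, h₂⟩ := hb.exists_eq_xMod_add (A + 1)
  obtain ⟨g₃, hg₃, h₃⟩ := hf A
  refine ⟨g₃ + f g₁ - g₂, sub_mem (add_mem hg₃ (hf.map_mem hg₁)) hg₂, ?_⟩
  rw [h₁, h₂, map_add, map_smul, h₃, smul_sub, smul_add]
  abel

end Bar

/-- The dual canonical basis `B*` of `O_q(M(n))` is invariant under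
multiplication by the quantum determinant: for every `b ∈ B*`, `det_q · b ∈ B*`. -/
theorem dual_canonical_basis_det_invariant (n : ℕ) (bar : Oq n → Oq n)
    (hbar : IsBar n bar) (b : Mat n → Oq n) (hb : IsDCB n bar b) (A : Mat n) :
    qDet n * b A ∈ Set.range b := by
  obtain ⟨g₁, hg₁, h₁⟩ := (isShift_mulLeft_qDet n).exists_map_eq hb A
  obtain ⟨g₂, hg₂, h₂⟩ := (isShift_mulRight_qDet n).exists_map_eq hb A
  rw [LinearMap.mulLeft_apply] at h₁
  rw [LinearMap.mulRight_apply] at h₂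
  have hz : bar (qDet n * b A - b (A + 1)) = b A * qDet n - b (A + 1) := by
    rw [sub_eq_add_neg, hbar.2.1, hbar.map_neg, hbar.2.2.2.1, hbar.map_qDet, hb.1, hb.1,
      ← sub_eq_add_neg]
  have hg₂0 : g₂ = 0 := hb.eq_zero_of_bar_eq hbar hg₁ hg₂ (by rw [← h₁, hz, h₂])
  refine ⟨A + 1, (sub_eq_zero.mp (hbar.1.1 ?_)).symm⟩
  rw [hz, h₂, hg₂0, smul_zero, hbar.map_zero]
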